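/- arXiv:2501.15643 — 15 statements merged into one kernel-verified Lean document; each statement's English description precedes it below -/
import Mathlib

section
/- For every sequence x = (x_n)_{n∈ℕ} in a real Banach space X there exist a real Banach space Y and a sequence u = (u_n)_{n∈ℕ} in Y such that: (a) for every finitely supported family of reals (a_n)_{n∈ℕ} and every choice of signs θ_n ∈ {−1,1}, ‖Σ_n θ_n a_n u_n‖ = ‖Σ_n a_n u_n‖ (the sequence u is 1-unconditional); (b) ‖u_n‖ ≥ 1 for every n; (c) B(u) = B(x); and consequently no infinite subset of ℕ belongs to C(u). -/
/-- `B(x)`: the family of all `A ⊆ ℕ` such that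
`sup {‖∑_{n ∈ F} x n‖ : F finite, F ⊆ A} < ∞`. -/
def BIdeal {X : Type*} [NormedAddCommGroup X] (x : ℕ → X) : Set (Set ℕ) :=
  {A | ∃ C : ℝ, ∀ F : Finset ℕ, (↑F : Set ℕ) ⊆ A → ‖∑ n ∈ F, x n‖ ≤ C}

/-- `C(x)`: the family of all `A ⊆ ℕ` such that `(x n)_{n ∈ A}` is summable
(unconditionally convergent). -/
def CIdeal {X : Type*} [NormedAddCommGroup X] (x : ℕ → X) : Set (Set ℕ) :=
  {A | Summable fun n : A => x n}

/-- The sign-invariant set of real sequences generated by the sequences `φ ∘ x`, for `φ` in the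
unit ball of the dual, together with the coordinate sequences `Pi.single m 1`. -/
def coordSet {X : Type*} [NormedAddCommGroup X] [NormedSpace ℝ X] (x : ℕ → X) : Set (ℕ → ℝ) :=
  {b | (∃ φ : X →L[ℝ] ℝ, ‖φ‖ ≤ 1 ∧ ∀ n, |b n| = |φ (x n)|) ∨
    ∃ m, ∀ n, |b n| = (Pi.single m 1 : ℕ → ℝ) n}

section

variable {X : Type*} [NormedAddCommGroup X] [NormedSpace ℝ X] {x : ℕ → X}

lemma abs_le_of_mem_coordSet {b : ℕ → ℝ} (hb : b ∈ coordSet x) (n : ℕ) :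
    |b n| ≤ max 1 ‖x n‖ := by
  rcases hb with ⟨φ, hφ, h⟩ | ⟨m, h⟩
  · rw [h]
    exact le_max_of_le_right (by simpa using φ.le_of_opNorm_le hφ (x n))
  · rw [h, Pi.single_apply]
    exact le_max_of_le_left (by split_ifs <;> norm_num)

lemma sign_mul_mem_coordSet {b θ : ℕ → ℝ} (hb : b ∈ coordSet x)
    (hθ : ∀ n, θ n = 1 ∨ θ n = -1) : (fun n => θ n * b n) ∈ coordSet x := by
  have habs : ∀ n, |θ n * b n| = |b n| := fun n => by rcases hθ n with h | h <;> simp [h]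
  simpa only [coordSet, Set.mem_ofPred_eq, habs] using hb

/-- The `n`-th coordinate, as a bounded continuous function on `coordSet x`. -/
noncomputable def coordFun (x : ℕ → X) (n : ℕ) : BoundedContinuousFunction (coordSet x) ℝ :=
  BoundedContinuousFunction.ofNormedAddCommGroup (fun b => b.1 n)
    ((continuous_apply n).comp continuous_subtype_val) (max 1 ‖x n‖)
    fun b => abs_le_of_mem_coordSet b.2 n

@[simp]
lemma coordFun_apply (n : ℕ) (b : coordSet x) : coordFun x n b = b.1 n := rfl

lemma norm_sum_sign_smul_coordFun_le (F : Finset ℕ) (a : ℕ → ℝ) {θ : ℕ → ℝ}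
    (hθ : ∀ n, θ n = 1 ∨ θ n = -1) :
    ‖∑ n ∈ F, (θ n * a n) • coordFun x n‖ ≤ ‖∑ n ∈ F, a n • coordFun x n‖ := by
  refine (BoundedContinuousFunction.norm_le (norm_nonneg _)).2 fun b => ?_
  convert (∑ n ∈ F, a n • coordFun x n).norm_coe_le_norm ⟨_, sign_mul_mem_coordSet b.2 hθ⟩ using 2
  simp only [BoundedContinuousFunction.coe_sum, Finset.sum_apply,
    BoundedContinuousFunction.coe_smul, coordFun_apply, smul_eq_mul]
  exact Finset.sum_congr rfl fun n _ => by ring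

lemma one_le_norm_coordFun (n : ℕ) : 1 ≤ ‖coordFun x n‖ := by
  have hmem : (Pi.single n 1 : ℕ → ℝ) ∈ coordSet x :=
    Or.inr ⟨n, fun k => by rw [Pi.single_apply]; split_ifs <;> simp⟩
  simpa using (coordFun x n).norm_coe_le_norm ⟨_, hmem⟩

lemma sum_abs_apply_le {φ : X →L[ℝ] ℝ} (hφ : ‖φ‖ ≤ 1) {C : ℝ} {F : Finset ℕ}
    (hC : ∀ G ⊆ F, ‖∑ n ∈ G, x n‖ ≤ C) : ∑ n ∈ F, |φ (x n)| ≤ 2 * C := by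
  have key : ∀ G ⊆ F, |∑ n ∈ G, φ (x n)| ≤ C := fun G hG => by
    rw [← map_sum]
    exact (by simpa using φ.le_of_opNorm_le hφ (∑ n ∈ G, x n) : _ ≤ _).trans (hC G hG)
  rw [← Finset.sum_filter_add_sum_filter_not F (fun n => 0 ≤ φ (x n))]
  have h1 : ∑ n ∈ F with 0 ≤ φ (x n), |φ (x n)| = ∑ n ∈ F with 0 ≤ φ (x n), φ (x n) :=
    Finset.sum_congr rfl fun n hn => abs_of_nonneg (Finset.mem_filter.1 hn).2
  have h2 : ∑ n ∈ F with ¬ 0 ≤ φ (x n), |φ (x n)| = -∑ n ∈ F with ¬ 0 ≤ φ (x n), φ (x n) := by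
    rw [← Finset.sum_neg_distrib]
    exact Finset.sum_congr rfl fun n hn => abs_of_neg (not_le.1 (Finset.mem_filter.1 hn).2)
  have k1 := (abs_le.1 (key _ (Finset.filter_subset (fun n => 0 ≤ φ (x n)) F))).2
  have k2 := (abs_le.1 (key _ (Finset.filter_subset (fun n => ¬ 0 ≤ φ (x n)) F))).1
  linarith

lemma BIdeal_coordFun (x : ℕ → X) : BIdeal (coordFun x) = BIdeal x := by
  ext A
  constructor
  · rintro ⟨C, hC⟩
    refine ⟨C, fun F hF => ?_⟩
    have hC0 : 0 ≤ C := (norm_nonneg _).trans (hC F hF)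
    obtain ⟨φ, hφ, hφx⟩ := exists_dual_vector'' ℝ (∑ n ∈ F, x n)
    have hmem : (fun n => φ (x n)) ∈ coordSet x := Or.inl ⟨φ, hφ, fun _ => rfl⟩
    have h := ((∑ n ∈ F, coordFun x n).norm_coe_le_norm ⟨_, hmem⟩).trans (hC F hF)
    simp only [BoundedContinuousFunction.coe_sum, Finset.sum_apply, coordFun_apply,
      ← map_sum, hφx] at h
    simpa using h
  · rintro ⟨C, hC⟩
    have hC0 : 0 ≤ C := (norm_nonneg _).trans (hC ∅ (by simp))
    refine ⟨2 * C + 1, fun F hF => (BoundedContinuousFunction.norm_le (by positivity)).2 ?_⟩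
    rintro ⟨b, hb⟩
    simp only [BoundedContinuousFunction.coe_sum, Finset.sum_apply, coordFun_apply]
    refine (Finset.abs_sum_le_sum_abs _ _).trans ?_
    rcases hb with ⟨φ, hφ, h⟩ | ⟨m, h⟩
    · simp only [h]
      have := sum_abs_apply_le hφ fun G (hG : G ⊆ F) =>
        hC G ((Finset.coe_subset.2 hG).trans hF)
      linarith
    · simp only [h, Pi.single_apply, Finset.sum_ite_eq']
      split_ifs <;> linarith

end

lemma finite_of_mem_CIdeal {Y : Type*} [NormedAddCommGroup Y] {u : ℕ → Y}
    (hu : ∀ n, 1 ≤ ‖u n‖) {A : Set ℕ} (hA : A ∈ CIdeal u) : A.Finite := by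
  have h := (Summable.tendsto_cofinite_zero hA).norm.eventually_lt_const
    (by simp : ‖(0 : Y)‖ < 1)
  have h' : ∀ᶠ _ : A in Filter.cofinite, False := h.mono fun n hn => (hu n).not_gt hn
  rw [Filter.eventually_cofinite] at h'
  simp only [not_false_eq_true, Set.ofPred_true] at h'
  exact Set.finite_coe_iff.1 (Set.finite_univ_iff.1 h')

theorem stmt0 {X : Type*} [NormedAddCommGroup X] [NormedSpace ℝ X] [CompleteSpace X]
    (x : ℕ → X) :
    ∃ (Y : Type) (_ : NormedAddCommGroup Y) (_ : NormedSpace ℝ Y) (_ : CompleteSpace Y)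
      (u : ℕ → Y),
      (∀ (F : Finset ℕ) (a θ : ℕ → ℝ), (∀ n, θ n = 1 ∨ θ n = -1) →
        ‖∑ n ∈ F, (θ n * a n) • u n‖ = ‖∑ n ∈ F, a n • u n‖) ∧
      (∀ n, 1 ≤ ‖u n‖) ∧
      BIdeal u = BIdeal x ∧
      (∀ A ∈ CIdeal u, A.Finite) := by
  refine ⟨BoundedContinuousFunction (coordSet x) ℝ, inferInstance, inferInstance, inferInstance,
    coordFun x, fun F a θ hθ => (norm_sum_sign_smul_coordFun_le F a hθ).antisymm ?_,
    one_le_norm_coordFun, BIdeal_coordFun x, fun A => finite_of_mem_CIdeal one_le_norm_coordFun⟩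
  have hθa : ∀ n, θ n * (θ n * a n) = a n := fun n => by rcases hθ n with h | h <;> simp [h]
  simpa only [hθa] using norm_sum_sign_smul_coordFun_le (x := x) F (fun n => θ n * a n) hθ
end

section
/- Let x = (x_n)_{n∈ℕ} be a sequence in a real Banach space X such that B(x) is tall. Then x is weakly null: for every continuous linear functional f : X → ℝ, f(x_n) → 0 as n → ∞. -/
open Filter

/-- A family of subsets of `ℕ` is tall if every infinite subset of `ℕ`
has an infinite subset belonging to the family. -/
def Tall (I : Set (Set ℕ)) : Prop :=
  ∀ A : Set ℕ, A.Infinite → ∃ B ⊆ A, B.Infinite ∧ B ∈ I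

/-- If a continuous linear functional is bounded below by a fixed positive number at `x n` for all
`n` in a member `A` of `B(x)`, then `A` is finite. -/
theorem finite_of_mem_BIdeal {X : Type*} [NormedAddCommGroup X] [NormedSpace ℝ X]
    {x : ℕ → X} {A : Set ℕ} (hA : A ∈ BIdeal x) (f : X →L[ℝ] ℝ) {ε : ℝ} (hε : 0 < ε)
    (hf : ∀ n ∈ A, ε ≤ f (x n)) : A.Finite := by
  obtain ⟨C, hC⟩ := hA
  by_contra hinf
  obtain ⟨N, hN⟩ := exists_nat_gt (‖f‖ * C / ε)
  obtain ⟨F, hFA, rfl⟩ := Set.Infinite.exists_subset_card_eq hinf N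
  have hlower : F.card * ε ≤ f (∑ n ∈ F, x n) := by
    rw [map_sum, ← nsmul_eq_mul]
    exact Finset.card_nsmul_le_sum F _ ε fun n hn => hf n (hFA hn)
  have hupper : f (∑ n ∈ F, x n) ≤ ‖f‖ * C :=
    (le_abs_self _).trans (f.le_opNorm_of_le (hC F hFA))
  rw [div_lt_iff₀ hε] at hN
  linarith

theorem Tall.finite_setOf_le_apply {X : Type*} [NormedAddCommGroup X] [NormedSpace ℝ X]
    {x : ℕ → X} (hx : Tall (BIdeal x)) (f : X →L[ℝ] ℝ) {ε : ℝ} (hε : 0 < ε) :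
    {n | ε ≤ f (x n)}.Finite := by
  by_contra hinf
  obtain ⟨B, hBA, hB, hBx⟩ := hx _ hinf
  exact hB (finite_of_mem_BIdeal hBx f hε fun n hn => hBA hn)

theorem stmt1 {X : Type*} [NormedAddCommGroup X] [NormedSpace ℝ X] [CompleteSpace X]
    (x : ℕ → X) (htall : Tall (BIdeal x)) :
    ∀ f : X →L[ℝ] ℝ, Tendsto (fun n => f (x n)) atTop (nhds 0) := by
  intro f
  rw [Metric.tendsto_nhds]
  intro ε hε
  rw [← Nat.cofinite_eq_atTop]
  filter_upwards [(htall.finite_setOf_le_apply f hε).compl_mem_cofinite,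
    (htall.finite_setOf_le_apply (-f) hε).compl_mem_cofinite] with n hn hn'
  simp only [Set.mem_compl_iff, Set.mem_ofPred_eq, not_le, neg_apply] at hn hn'
  rw [Real.dist_eq, sub_zero, abs_lt]
  exact ⟨by linarith, hn⟩
end

section
/- Let x = (x_n)_{n∈ℕ} be a sequence in a real Banach space X. Then B(x) is tall if and only if for every infinite A ⊆ ℕ there is an infinite B ⊆ A such that either ‖x_n‖ → 0 as n → ∞ along n ∈ B, or there exists a constant C ≥ 1 such that (1/C)·max_{n∈F}|a_n| ≤ ‖Σ_{n∈F} a_n x_n‖ ≤ C·max_{n∈F}|a_n| for every finite F ⊆ B and all reals (a_n)_{n∈F} (i.e., (x_n)_{n∈B} is equivalent to the unit vector basis of c₀). -/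
open Filter

/-- **Rosenthal's lemma** for nonnegative matrices, in quantitative form: if the off-diagonal row
sums of `c` over an infinite set `A` are at most `K * ε`, then they are at most `ε` over some
infinite subset of `A`. -/
theorem exists_infinite_subset_off_diagonal_sum_le {c : ℕ → ℕ → ℝ} {ε : ℝ} (hε : 0 ≤ ε) (K : ℕ)
    {A : Set ℕ} (hA : A.Infinite)
    (h : ∀ n ∈ A, ∀ F : Finset ℕ, (↑F : Set ℕ) ⊆ A → n ∉ F → ∑ m ∈ F, c n m ≤ K * ε) :
    ∃ M ⊆ A, M.Infinite ∧
      ∀ n ∈ M, ∀ F : Finset ℕ, (↑F : Set ℕ) ⊆ M → n ∉ F → ∑ m ∈ F, c n m ≤ ε := by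
  induction K generalizing A with
  | zero => exact ⟨A, subset_rfl, hA, fun n hn F hF hnF => (h n hn F hF hnF).trans (by simpa)⟩
  | succ K ih =>
    let e : ℕ → ℕ := fun i => hA.natEmbedding A i
    have he : Function.Injective e :=
      Subtype.val_injective.comp (hA.natEmbedding A).injective
    have heA : ∀ i, e i ∈ A := fun i => (hA.natEmbedding A i).2
    let N : ℕ → Set ℕ := fun k => Set.range fun j => e (Nat.pair k j)
    have hNA : ∀ k, N k ⊆ A := by
      rintro k _ ⟨j, rfl⟩
      exact heA _
    have hNdisj : ∀ k l n, n ∈ N k → n ∈ N l → k = l := by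
      rintro k l _ ⟨i, rfl⟩ ⟨j, hj⟩
      exact (Nat.pair_eq_pair.1 (he hj)).1.symm
    by_cases hgood : ∃ k, ∀ n ∈ N k, ∀ F : Finset ℕ, (↑F : Set ℕ) ⊆ N k → n ∉ F →
        ∑ m ∈ F, c n m ≤ ε
    · obtain ⟨k, hk⟩ := hgood
      refine ⟨N k, hNA k, Set.infinite_range_of_injective fun i j hij => ?_, hk⟩
      exact (Nat.pair_eq_pair.1 (he hij)).2
    · push Not at hgood
      choose n hnN F hFN hnF hlt using hgood
      have hn : Function.Injective n := fun k l hkl => hNdisj k l _ (hnN k) (hkl ▸ hnN l)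
      have hrange : Set.range n ⊆ A := by
        rintro _ ⟨k, rfl⟩
        exact hNA k (hnN k)
      obtain ⟨M, hM, hMinf, hMε⟩ := ih (Set.infinite_range_of_injective hn) (by
        rintro _ ⟨k, rfl⟩ G hG hkG
        have hdisj : Disjoint (F k) G := by
          refine Finset.disjoint_left.2 fun m hmF hmG => hkG ?_
          obtain ⟨l, rfl⟩ := hG hmG
          rwa [hNdisj k l _ (hFN k hmF) (hnN l)]
        have hle := h (n k) (hrange ⟨k, rfl⟩) (F k ∪ G)
          (by
            rw [Finset.coe_union]
            exact Set.union_subset ((hFN k).trans (hNA k)) (hG.trans hrange))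
          (by simp [hnF k, hkG])
        rw [Finset.sum_union hdisj] at hle
        push_cast at hle
        linarith [hlt k])
      exact ⟨M, hM.trans hrange, hMinf, hMε⟩

section

variable {X : Type*} [NormedAddCommGroup X] {x : ℕ → X} {B : Set ℕ} {C : ℝ}

theorem mem_BIdeal_range_of_norm_le_pow {φ : ℕ → ℕ} (hφ : Function.Injective φ)
    (h : ∀ k, ‖x (φ k)‖ ≤ (1 / 2 : ℝ) ^ k) : Set.range φ ∈ BIdeal x := by
  refine ⟨2, fun F hF => ?_⟩
  obtain ⟨G, rfl⟩ : ∃ G : Finset ℕ, G.image φ = F := by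
    rw [← Set.image_univ] at hF
    obtain ⟨G, -, hG⟩ := Finset.subset_set_image_iff.1 hF
    exact ⟨G, hG⟩
  rw [Finset.sum_image hφ.injOn]
  calc ‖∑ k ∈ G, x (φ k)‖ ≤ ∑ k ∈ G, (1 / 2 : ℝ) ^ k :=
        norm_sum_le_of_le _ fun k _ => h k
    _ ≤ ∑' k : ℕ, (1 / 2 : ℝ) ^ k :=
        summable_geometric_two.sum_le_tsum _ fun k _ => by positivity
    _ = 2 := tsum_geometric_two

theorem exists_infinite_subset_mem_BIdeal_of_tendsto (hB : B.Infinite)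
    (h : Tendsto (fun n => ‖x n‖) (atTop ⊓ 𝓟 B) (nhds 0)) :
    ∃ M ⊆ B, M.Infinite ∧ M ∈ BIdeal x := by
  obtain ⟨φ, hφ, hφB⟩ := extraction_forall_of_frequently
    (P := fun k n => n ∈ B ∧ ‖x n‖ ≤ (1 / 2 : ℝ) ^ k) (fun k => by
      have hle : ∀ᶠ n in atTop, n ∈ B → ‖x n‖ ≤ (1 / 2 : ℝ) ^ k :=
        eventually_inf_principal.1 (h.eventually_le_const (by positivity))
      exact ((Nat.frequently_atTop_iff_infinite.2 hB).and_eventually hle).mono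
        fun n hn => ⟨hn.1, hn.2 hn.1⟩)
  refine ⟨Set.range φ, ?_, Set.infinite_range_of_injective hφ.injective,
    mem_BIdeal_range_of_norm_le_pow hφ.injective fun k => (hφB k).2⟩
  rintro _ ⟨k, rfl⟩
  exact (hφB k).1

theorem tendsto_norm_zero_of_finite_setOf_le
    (h : ∀ δ > 0, {n ∈ B | δ ≤ ‖x n‖}.Finite) :
    Tendsto (fun n => ‖x n‖) (atTop ⊓ 𝓟 B) (nhds 0) := by
  rw [Metric.tendsto_nhds]
  intro δ hδ
  rw [eventually_inf_principal, ← Nat.cofinite_eq_atTop]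
  filter_upwards [(h δ hδ).compl_mem_cofinite] with n hn hnB
  rw [dist_zero_right, norm_norm]
  by_contra! hle
  exact hn ⟨hnB, hle⟩

variable [NormedSpace ℝ X]

theorem sum_abs_apply_le_of_norm_sum_le
    (hB : ∀ F : Finset ℕ, (↑F : Set ℕ) ⊆ B → ‖∑ n ∈ F, x n‖ ≤ C)
    {f : StrongDual ℝ X} (hf : ‖f‖ ≤ 1) {F : Finset ℕ} (hF : (↑F : Set ℕ) ⊆ B) :
    ∑ n ∈ F, |f (x n)| ≤ 2 * C := by
  have key : ∀ G ⊆ F, |∑ n ∈ G, f (x n)| ≤ C := fun G hG => by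
    rw [← map_sum, ← Real.norm_eq_abs]
    exact (f.le_of_opNorm_le hf _).trans
      ((one_mul _).trans_le (hB G ((Finset.coe_subset.2 hG).trans hF)))
  rw [← Finset.sum_filter_add_sum_filter_not F (fun n => 0 ≤ f (x n))]
  have hpos : ∑ n ∈ F with 0 ≤ f (x n), |f (x n)| = ∑ n ∈ F with 0 ≤ f (x n), f (x n) :=
    Finset.sum_congr rfl fun n hn => abs_of_nonneg (Finset.mem_filter.1 hn).2
  have hneg : ∑ n ∈ F with ¬ 0 ≤ f (x n), |f (x n)| = -∑ n ∈ F with ¬ 0 ≤ f (x n), f (x n) := by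
    rw [← Finset.sum_neg_distrib]
    exact Finset.sum_congr rfl fun n hn =>
      abs_of_neg (not_le.1 (Finset.mem_filter.1 hn).2)
  rw [hpos, hneg]
  linarith [(abs_le.1 (key _ (F.filter_subset fun n => 0 ≤ f (x n)))).2,
    (abs_le.1 (key _ (F.filter_subset fun n => ¬ 0 ≤ f (x n)))).1]

theorem norm_sum_smul_le_of_norm_sum_le
    (hB : ∀ F : Finset ℕ, (↑F : Set ℕ) ⊆ B → ‖∑ n ∈ F, x n‖ ≤ C)
    {F : Finset ℕ} (hF : (↑F : Set ℕ) ⊆ B) {a : ℕ → ℝ} {S : ℝ} (hS : 0 ≤ S)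
    (ha : ∀ n ∈ F, |a n| ≤ S) :
    ‖∑ n ∈ F, a n • x n‖ ≤ 2 * C * S := by
  obtain ⟨g, hg, hgx⟩ := exists_dual_vector'' ℝ (∑ n ∈ F, a n • x n)
  calc ‖∑ n ∈ F, a n • x n‖ = ∑ n ∈ F, a n * g (x n) := by
        simpa using hgx.symm
    _ ≤ ∑ n ∈ F, S * |g (x n)| := Finset.sum_le_sum fun n hn =>
        (le_abs_self _).trans (by rw [abs_mul]; gcongr; exact ha n hn)
    _ = S * ∑ n ∈ F, |g (x n)| := (Finset.mul_sum _ _ _).symm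
    _ ≤ S * (2 * C) := by gcongr; exact sum_abs_apply_le_of_norm_sum_le hB hg hF
    _ = 2 * C * S := mul_comm _ _

/-- If the off-diagonal part of the row at `k` of a norm-one functional is at most `δ / 2`, while
its diagonal entry is at least `δ`, then it bounds from below the norm of any linear combination
whose largest coefficient sits at `k`. -/
theorem mul_abs_le_norm_sum_smul {f : StrongDual ℝ X} (hf : ‖f‖ ≤ 1) {F : Finset ℕ} {k : ℕ}
    (hk : k ∈ F) {a : ℕ → ℝ} (ha : ∀ n ∈ F, |a n| ≤ |a k|) {δ : ℝ} (hdiag : δ ≤ f (x k))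
    (hoff : ∑ n ∈ F.erase k, |f (x n)| ≤ δ / 2) :
    δ / 2 * |a k| ≤ ‖∑ n ∈ F, a n • x n‖ := by
  have hsum : f (∑ n ∈ F, a n • x n) = a k * f (x k) + ∑ n ∈ F.erase k, a n * f (x n) := by
    rw [map_sum, ← Finset.add_sum_erase F _ hk]
    simp
  have hrest : |∑ n ∈ F.erase k, a n * f (x n)| ≤ |a k| * (δ / 2) :=
    calc |∑ n ∈ F.erase k, a n * f (x n)| ≤ ∑ n ∈ F.erase k, |a k| * |f (x n)| :=
          (Finset.abs_sum_le_sum_abs _ _).trans <| Finset.sum_le_sum fun n hn => by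
            rw [abs_mul]
            exact mul_le_mul_of_nonneg_right (ha n (Finset.mem_of_mem_erase hn)) (abs_nonneg _)
      _ = |a k| * ∑ n ∈ F.erase k, |f (x n)| := (Finset.mul_sum _ _ _).symm
      _ ≤ |a k| * (δ / 2) := by gcongr
  have hmain : |a k| * δ ≤ |a k * f (x k)| := by
    rw [abs_mul]
    gcongr
    exact hdiag.trans (le_abs_self _)
  have htri := abs_sub_abs_le_abs_sub (a k * f (x k)) (-∑ n ∈ F.erase k, a n * f (x n))
  rw [sub_neg_eq_add, ← hsum, abs_neg] at htri
  have hle : |f (∑ n ∈ F, a n • x n)| ≤ ‖∑ n ∈ F, a n • x n‖ := by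
    simpa using f.le_of_opNorm_le hf (∑ n ∈ F, a n • x n)
  linarith

/-- A sequence with bounded finite sums and norms bounded away from zero has a subsequence
equivalent to the unit vector basis of `c₀`. -/
theorem exists_infinite_subset_equivalent_c0 (hBinf : B.Infinite)
    (hB : ∀ F : Finset ℕ, (↑F : Set ℕ) ⊆ B → ‖∑ n ∈ F, x n‖ ≤ C)
    {δ : ℝ} (hδ : 0 < δ) (hx : ∀ n ∈ B, δ ≤ ‖x n‖) :
    ∃ M ⊆ B, M.Infinite ∧ ∃ D : ℝ, 1 ≤ D ∧
      ∀ (F : Finset ℕ) (hF : F.Nonempty), (↑F : Set ℕ) ⊆ M → ∀ a : ℕ → ℝ,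
        (1 / D) * F.sup' hF (fun n => |a n|) ≤ ‖∑ n ∈ F, a n • x n‖ ∧
        ‖∑ n ∈ F, a n • x n‖ ≤ D * F.sup' hF (fun n => |a n|) := by
  choose f hf hfx using fun n => exists_dual_vector'' ℝ (x n)
  obtain ⟨K, hK⟩ := exists_nat_ge (2 * C / (δ / 2))
  rw [div_le_iff₀ (half_pos hδ)] at hK
  obtain ⟨M, hMB, hM, hoff⟩ := exists_infinite_subset_off_diagonal_sum_le
    (c := fun n m => |f n (x m)|) (half_pos hδ).le K hBinf
    fun n _ F hF _ => (sum_abs_apply_le_of_norm_sum_le hB (hf n) hF).trans hK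
  refine ⟨M, hMB, hM, max 1 (max (2 * C) (2 / δ)), le_max_left _ _, fun F hF hFM a => ?_⟩
  set D := max 1 (max (2 * C) (2 / δ))
  have hCD : 2 * C ≤ D := (le_max_left _ _).trans (le_max_right _ _)
  have hδD : 2 / δ ≤ D := (le_max_right _ _).trans (le_max_right _ _)
  obtain ⟨k, hk, hkmax⟩ := F.exists_mem_eq_sup' hF fun n => |a n|
  have ha : ∀ n ∈ F, |a n| ≤ |a k| := fun n hn =>
    hkmax ▸ Finset.le_sup' (fun n => |a n|) hn
  rw [hkmax]
  constructor
  · refine le_trans ?_ (mul_abs_le_norm_sum_smul (δ := δ) (hf k) hk ha ?_ ?_)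
    · refine mul_le_mul_of_nonneg_right ?_ (abs_nonneg _)
      simpa using one_div_le_one_div_of_le (by positivity) hδD
    · simpa [hfx k] using hx k (hMB (hFM hk))
    · exact hoff k (hFM hk) _ ((Finset.coe_subset.2 (F.erase_subset k)).trans hFM)
        (F.notMem_erase k)
  · exact (norm_sum_smul_le_of_norm_sum_le hB (hFM.trans hMB) (abs_nonneg _) ha).trans
      (by gcongr)

end

theorem stmt2 {X : Type*} [NormedAddCommGroup X] [NormedSpace ℝ X] [CompleteSpace X]
    (x : ℕ → X) :
    Tall (BIdeal x) ↔
      ∀ A : Set ℕ, A.Infinite → ∃ B ⊆ A, B.Infinite ∧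
        (Tendsto (fun n => ‖x n‖) (atTop ⊓ 𝓟 B) (nhds 0) ∨
          ∃ C : ℝ, 1 ≤ C ∧
            ∀ (F : Finset ℕ) (hF : F.Nonempty), (↑F : Set ℕ) ⊆ B → ∀ a : ℕ → ℝ,
              (1 / C) * F.sup' hF (fun n => |a n|) ≤ ‖∑ n ∈ F, a n • x n‖ ∧
              ‖∑ n ∈ F, a n • x n‖ ≤ C * F.sup' hF (fun n => |a n|)) := by
  constructor
  · intro h A hA
    obtain ⟨B, hBA, hBinf, C, hC⟩ := h A hA
    by_cases hfin : ∀ δ > 0, {n ∈ B | δ ≤ ‖x n‖}.Finite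
    · exact ⟨B, hBA, hBinf, .inl (tendsto_norm_zero_of_finite_setOf_le hfin)⟩
    · push Not at hfin
      obtain ⟨δ, hδ, hinf⟩ := hfin
      have hsub : {n ∈ B | δ ≤ ‖x n‖} ⊆ B := Set.sep_subset _ _
      obtain ⟨M, hM, hMinf, hc0⟩ := exists_infinite_subset_equivalent_c0 hinf
        (fun F hF => hC F (hF.trans hsub)) hδ fun n hn => hn.2
      exact ⟨M, hM.trans (hsub.trans hBA), hMinf, .inr hc0⟩
  · intro h A hA
    obtain ⟨B, hBA, hB, hx | ⟨C, hC, hc0⟩⟩ := h A hA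
    · obtain ⟨M, hMB, hM⟩ := exists_infinite_subset_mem_BIdeal_of_tendsto hB hx
      exact ⟨M, hMB.trans hBA, hM⟩
    · refine ⟨B, hBA, hB, C, fun F hF => ?_⟩
      obtain rfl | hne := F.eq_empty_or_nonempty
      · simpa using zero_le_one.trans hC
      · simpa using (hc0 F hne hF fun _ => 1).2
end

section
/- Let H be a real inner product space, C ≥ 1, and x = (x_n)_{n∈ℕ} a sequence in H that is C-unconditional, meaning that for every finitely supported family of reals (a_n)_{n∈ℕ} and every choice of signs θ_n ∈ {−1,1} one has ‖Σ_n θ_n a_n x_n‖ ≤ C·‖Σ_n a_n x_n‖. Then for every A ⊆ ℕ: A ∈ B(x) if and only if Σ_{n∈A} ‖x_n‖² < ∞. -/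
/-- For any `s`, signs can be chosen so that the deviation of `‖∑ θ n • x n‖ ^ 2` from
`∑ ‖x n‖ ^ 2` has the same sign as `s`. -/
theorem exists_signs_mul_norm_sq_sub_nonneg {ι H : Type*} [NormedAddCommGroup H]
    [InnerProductSpace ℝ H] (s : ℝ) (x : ι → H) (F : Finset ι) :
    ∃ θ : ι → ℝ, (∀ n, θ n = 1 ∨ θ n = -1) ∧
      0 ≤ s * (‖∑ n ∈ F, θ n • x n‖ ^ 2 - ∑ n ∈ F, ‖x n‖ ^ 2) := by
  classical
  induction F using Finset.induction_on with
  | empty => exact ⟨fun _ => 1, fun _ => Or.inl rfl, by simp⟩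
  | insert m F hm ih =>
    obtain ⟨θ, hθ, h⟩ := ih
    obtain ⟨ε, hε, hεs⟩ : ∃ ε : ℝ, (ε = 1 ∨ ε = -1) ∧
        0 ≤ s * (ε * inner ℝ (x m) (∑ n ∈ F, θ n • x n)) := by
      rcases le_total 0 (s * inner ℝ (x m) (∑ n ∈ F, θ n • x n)) with h0 | h0
      · exact ⟨1, Or.inl rfl, by simpa using h0⟩
      · exact ⟨-1, Or.inr rfl, by linarith⟩
    refine ⟨Function.update θ m ε, fun n => ?_, ?_⟩
    · rcases eq_or_ne n m with rfl | hn
      · simpa using hε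
      · simpa [hn] using hθ n
    · have hsum : ∑ n ∈ F, Function.update θ m ε n • x n = ∑ n ∈ F, θ n • x n :=
        Finset.sum_congr rfl fun n hn => by
          rw [Function.update_of_ne (ne_of_mem_of_not_mem hn hm)]
      have hnorm : ‖ε • x m‖ = ‖x m‖ := by rcases hε with rfl | rfl <;> simp
      rw [Finset.sum_insert hm, Finset.sum_insert hm, hsum, Function.update_self,
        norm_add_sq_real, hnorm, real_inner_smul_left]
      linarith

theorem stmt4 {H : Type*} [NormedAddCommGroup H] [InnerProductSpace ℝ H]
    (C : ℝ) (hC : 1 ≤ C) (x : ℕ → H)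
    (huncond : ∀ (F : Finset ℕ) (a θ : ℕ → ℝ), (∀ n, θ n = 1 ∨ θ n = -1) →
      ‖∑ n ∈ F, (θ n * a n) • x n‖ ≤ C * ‖∑ n ∈ F, a n • x n‖) :
    ∀ A : Set ℕ, A ∈ BIdeal x ↔ Summable fun n : A => ‖x n‖ ^ 2 := by
  intro A
  constructor
  · rintro ⟨K, hK⟩
    refine summable_of_sum_le (c := (C * K) ^ 2) (fun _ => by positivity) fun u => ?_
    have hu := hK (u.map (Function.Embedding.subtype _)) (by simp)
    obtain ⟨θ, hθ, h⟩ := exists_signs_mul_norm_sq_sub_nonneg 1 x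
      (u.map (Function.Embedding.subtype _))
    have hle := huncond (u.map (Function.Embedding.subtype _)) (fun _ => 1) θ hθ
    simp only [mul_one, one_smul] at hle
    have hsq := pow_le_pow_left₀ (norm_nonneg _)
      (hle.trans (mul_le_mul_of_nonneg_left hu (by linarith))) 2
    have hmap : ∑ n ∈ u.map (Function.Embedding.subtype _), ‖x n‖ ^ 2 = ∑ n ∈ u, ‖x n‖ ^ 2 :=
      Finset.sum_map _ _ _
    linarith
  · intro hsum
    refine ⟨C * √(∑' n : A, ‖x n‖ ^ 2), fun F hF => ?_⟩
    obtain ⟨θ, hθ, h⟩ := exists_signs_mul_norm_sq_sub_nonneg (-1) x F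
    have hle := huncond F θ θ hθ
    have hθθ : ∀ n, θ n * θ n = 1 := fun n => by rcases hθ n with h | h <;> simp [h]
    simp only [hθθ, one_smul] at hle
    refine hle.trans (mul_le_mul_of_nonneg_left (Real.le_sqrt_of_sq_le ?_) (by linarith))
    classical
    have htsum := hsum.sum_le_tsum (F.subtype (· ∈ A)) fun _ _ => by positivity
    rw [Finset.sum_subtype_of_mem (fun n => ‖x n‖ ^ 2) fun n hn => hF hn] at htsum
    linarith
end

section
/- Let X be a real Banach space, let 2 ≤ q < ∞ and C > 0 be such that X has cotype q with constant C, i.e., for every finite family y_1, …, y_m of vectors of X one has (Σ_{k=1}^m ‖y_k‖^q)^{1/q} ≤ C · 2^{−m} Σ_{θ∈{−1,1}^m} ‖Σ_{k=1}^m θ_k y_k‖. Then for every sequence x = (x_n)_{n∈ℕ} in X and every A ⊆ ℕ: if Σ_{n∈A} ‖x_n‖ < ∞ then A ∈ B(x), and if A ∈ B(x) then Σ_{n∈A} ‖x_n‖^q < ∞. -/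
theorem mem_BIdeal_of_summable_norm {X : Type*} [NormedAddCommGroup X] {x : ℕ → X} {A : Set ℕ}
    (h : Summable fun n : A => ‖x n‖) : A ∈ BIdeal x := by
  classical
  refine ⟨∑' n : A, ‖x n‖, fun F hF => ?_⟩
  calc ‖∑ n ∈ F, x n‖ ≤ ∑ n ∈ F, ‖x n‖ := norm_sum_le _ _
    _ = ∑ n ∈ F.subtype (· ∈ A), ‖x n‖ :=
      (Finset.sum_subtype_of_mem (fun n => ‖x n‖) fun n hn => hF hn).symm
    _ ≤ ∑' n : A, ‖x n‖ := h.sum_le_tsum _ fun _ _ => norm_nonneg _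

/-- If all subsums of a finite family have norm at most `M`, then all its signed sums have norm
at most `2 * M`. -/
theorem norm_sum_sign_smul_le {ι X : Type*} [Fintype ι] [NormedAddCommGroup X] [NormedSpace ℝ X]
    {y : ι → X} {M : ℝ} (hM : ∀ s : Finset ι, ‖∑ k ∈ s, y k‖ ≤ M) (θ : ι → Bool) :
    ‖∑ k, (if θ k then (1 : ℝ) else -1) • y k‖ ≤ 2 * M := by
  have h : ∑ k, (if θ k then (1 : ℝ) else -1) • y k =
      ∑ k with θ k, y k - ∑ k with ¬ θ k, y k := by
    simp only [ite_smul, one_smul, neg_smul, Finset.sum_ite, Finset.sum_neg_distrib,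
      sub_eq_add_neg]
  rw [h, two_mul]
  exact (norm_sub_le _ _).trans (add_le_add (hM _) (hM _))

theorem stmt5 {X : Type*} [NormedAddCommGroup X] [NormedSpace ℝ X] [CompleteSpace X]
    (q C : ℝ) (hq : 2 ≤ q) (hC : 0 < C)
    (hcotype : ∀ (m : ℕ) (y : Fin m → X),
      (∑ k, ‖y k‖ ^ q) ^ (1 / q) ≤
        C * ((2 : ℝ) ^ m)⁻¹ *
          ∑ θ : Fin m → Bool, ‖∑ k, (if θ k then (1 : ℝ) else -1) • y k‖) :
    ∀ (x : ℕ → X) (A : Set ℕ),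
      ((Summable fun n : A => ‖x n‖) → A ∈ BIdeal x) ∧
      (A ∈ BIdeal x → Summable fun n : A => ‖x n‖ ^ q) := by
  refine fun x A => ⟨mem_BIdeal_of_summable_norm, ?_⟩
  rintro ⟨M, hM⟩
  have hq0 : 0 < q := by linarith
  refine summable_of_sum_le (c := (C * (2 * M)) ^ q)
    (fun n => Real.rpow_nonneg (norm_nonneg _) q) fun u => ?_
  let e : Fin u.card ↪ ℕ :=
    (u.equivFin.symm.toEmbedding.trans (Function.Embedding.subtype _)).trans
      (Function.Embedding.subtype _)
  have he : ∑ k, ‖x (e k)‖ ^ q = ∑ n ∈ u, ‖x n‖ ^ q := by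
    rw [← Finset.sum_coe_sort u]
    exact Equiv.sum_comp u.equivFin.symm fun n => ‖x n‖ ^ q
  have hsub (s : Finset (Fin u.card)) : ‖∑ k ∈ s, x (e k)‖ ≤ M := by
    rw [← Finset.sum_map s e x]
    refine hM _ fun n hn => ?_
    obtain ⟨k, -, rfl⟩ := Finset.mem_map.1 hn
    exact (u.equivFin.symm k).1.2
  have hsum : ∑ θ : Fin u.card → Bool, ‖∑ k, (if θ k then (1 : ℝ) else -1) • x (e k)‖ ≤
      2 ^ u.card * (2 * M) := by
    refine (Finset.sum_le_card_nsmul _ _ _ fun θ _ => norm_sum_sign_smul_le hsub θ).trans_eq ?_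
    simp
  have hS : 0 ≤ ∑ k, ‖x (e k)‖ ^ q := by positivity
  have hroot : (∑ k, ‖x (e k)‖ ^ q) ^ (1 / q) ≤ C * (2 * M) := by
    refine (hcotype _ _).trans ((mul_le_mul_of_nonneg_left hsum (by positivity)).trans_eq ?_)
    field_simp
  rw [← he]
  calc ∑ k, ‖x (e k)‖ ^ q = ((∑ k, ‖x (e k)‖ ^ q) ^ (1 / q)) ^ q := by
        rw [one_div, Real.rpow_inv_rpow hS hq0.ne']
    _ ≤ (C * (2 * M)) ^ q := Real.rpow_le_rpow (by positivity) hroot hq0.le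
end

section
/- Let K be a nonempty compact metric space and g = (g_n)_{n∈ℕ} a sequence in C(K, ℝ) (continuous real-valued functions with the supremum norm), and let |g| denote the sequence (|g_n|)_{n∈ℕ} of pointwise absolute values. Then B(g) = B(|g|) and C(g) = C(|g|). -/
namespace ContinuousMap

variable {K ι : Type*} [TopologicalSpace K] [CompactSpace K]

/-- The norm of a finite sum is at most the norm of the sum of the absolute values. -/
theorem norm_sum_le_norm_sum_abs (f : ι → C(K, ℝ)) (F : Finset ι) :
    ‖∑ i ∈ F, f i‖ ≤ ‖∑ i ∈ F, |f i|‖ := by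
  refine (norm_le _ (norm_nonneg _)).2 fun x => ?_
  refine le_trans ?_ (norm_coe_le_norm _ x)
  simp only [sum_apply, abs_apply, Real.norm_eq_abs]
  exact (Finset.abs_sum_le_sum_abs _ _).trans (le_abs_self _)

/-- If all subsums of a finite sum have norm at most `C`, then the sum of the absolute values has
norm at most `2 * C`. -/
theorem norm_sum_abs_le_two_mul (f : ι → C(K, ℝ)) (F : Finset ι) {C : ℝ}
    (h : ∀ t ⊆ F, ‖∑ i ∈ t, f i‖ ≤ C) : ‖∑ i ∈ F, |f i|‖ ≤ 2 * C := by
  have hC : 0 ≤ C := (norm_nonneg _).trans (h F subset_rfl)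
  refine (norm_le _ (by positivity)).2 fun x => ?_
  have bound : ∀ t ⊆ F, |∑ i ∈ t, f i x| ≤ C := fun t ht => by
    simpa only [sum_apply, Real.norm_eq_abs] using (norm_coe_le_norm _ x).trans (h t ht)
  have hpos := (abs_le.1 (bound _ (F.filter_subset fun i => 0 ≤ f i x))).2
  have hneg := (abs_le.1 (bound _ (F.filter_subset fun i => ¬ 0 ≤ f i x))).1
  simp only [sum_apply, abs_apply, Real.norm_eq_abs]
  rw [abs_of_nonneg (Finset.sum_nonneg fun _ _ => abs_nonneg _),
    ← Finset.sum_filter_add_sum_filter_not F (fun i => 0 ≤ f i x)]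
  have e₁ : ∑ i ∈ F with 0 ≤ f i x, |f i x| = ∑ i ∈ F with 0 ≤ f i x, f i x :=
    Finset.sum_congr rfl fun i hi => abs_of_nonneg (Finset.mem_filter.1 hi).2
  have e₂ : ∑ i ∈ F with ¬ 0 ≤ f i x, |f i x| = -∑ i ∈ F with ¬ 0 ≤ f i x, f i x := by
    rw [← Finset.sum_neg_distrib]
    exact Finset.sum_congr rfl fun i hi => abs_of_neg (not_le.1 (Finset.mem_filter.1 hi).2)
  rw [e₁, e₂]
  linarith

/-- A family in `C(K, ℝ)` is summable if and only if its family of absolute values is. -/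
theorem summable_abs_iff_summable (f : ι → C(K, ℝ)) : (Summable fun i => |f i|) ↔ Summable f := by
  rw [summable_iff_vanishing_norm, summable_iff_vanishing_norm]
  refine ⟨fun h ε hε => ?_, fun h ε hε => ?_⟩
  · obtain ⟨s, hs⟩ := h ε hε
    exact ⟨s, fun t ht => (norm_sum_le_norm_sum_abs f t).trans_lt (hs t ht)⟩
  · obtain ⟨s, hs⟩ := h (ε / 3) (by positivity)
    refine ⟨s, fun t ht => ?_⟩
    have := norm_sum_abs_le_two_mul f t fun u hu => (hs u (ht.mono_left hu)).le
    linarith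

end ContinuousMap

theorem stmt6 {K : Type*} [MetricSpace K] [CompactSpace K] [Nonempty K]
    (g : ℕ → C(K, ℝ)) :
    BIdeal g = BIdeal (fun n => |g n|) ∧ CIdeal g = CIdeal (fun n => |g n|) := by
  refine ⟨Set.ext fun A => ⟨?_, ?_⟩, Set.ext fun A => ?_⟩
  · rintro ⟨C, hC⟩
    exact ⟨2 * C, fun F hF => ContinuousMap.norm_sum_abs_le_two_mul g F fun t ht =>
      hC t ((Finset.coe_subset.2 ht).trans hF)⟩
  · rintro ⟨C, hC⟩
    exact ⟨C, fun F hF => (ContinuousMap.norm_sum_le_norm_sum_abs g F).trans (hC F hF)⟩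
  · exact (ContinuousMap.summable_abs_iff_summable fun n : A => g n).symm
end

section
/- Let K be a compact metric space, g = (g_n)_{n∈ℕ} a sequence of non-negative functions in C(K, ℝ), and α : ℕ → K a sequence whose range is dense in K and such that for every k the set {j ∈ ℕ : α_j = α_k} is infinite. For k ∈ ℕ and A ⊆ ℕ set μ_k(A) := Σ_{n∈A, n<k} g_n(α_k). Then for every A ⊆ ℕ: A ∈ B(g), i.e. sup{‖Σ_{n∈F} g_n‖_∞ : F a finite subset of A} < ∞, if and only if sup_{k∈ℕ} μ_k(A) < ∞. -/
theorem stmt7 {K : Type*} [MetricSpace K] [CompactSpace K]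
    (g : ℕ → C(K, ℝ)) (hg : ∀ n, 0 ≤ g n)
    (α : ℕ → K) (hdense : DenseRange α)
    (hrep : ∀ k, {j : ℕ | α j = α k}.Infinite) :
    ∀ A : Set ℕ,
      A ∈ BIdeal g ↔
        ∃ C : ℝ, ∀ k : ℕ,
          ∑ n ∈ Finset.range k, A.indicator (fun i => (g i) (α k)) n ≤ C := by
  classical
  intro A
  have hg' : ∀ n x, 0 ≤ g n x := fun n x => hg n x
  have heval : ∀ (F : Finset ℕ) (x : K), (∑ n ∈ F, g n) x = ∑ n ∈ F, g n x := fun F x => by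
    simp
  constructor
  · rintro ⟨C, hC⟩
    refine ⟨C, fun k => ?_⟩
    have hF := hC ((Finset.range k).filter (· ∈ A)) (by intro n; simp)
    calc ∑ n ∈ Finset.range k, A.indicator (fun i => (g i) (α k)) n
        = (∑ n ∈ (Finset.range k).filter (· ∈ A), g n) (α k) := by
          rw [heval, Finset.sum_filter]
          exact Finset.sum_congr rfl fun n _ => Set.indicator_apply _ _ _
      _ ≤ ‖(∑ n ∈ (Finset.range k).filter (· ∈ A), g n) (α k)‖ := Real.le_norm_self _
      _ ≤ C := (ContinuousMap.norm_coe_le_norm _ _).trans hF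
  · rintro ⟨C, hC⟩
    have hC0 : 0 ≤ C := by simpa using hC 0
    refine ⟨C, fun F hF => (ContinuousMap.norm_le _ hC0).2 fun x => ?_⟩
    refine hdense.induction_on (p := fun x => ‖(∑ n ∈ F, g n) x‖ ≤ C) x
      (isClosed_le (by fun_prop) continuous_const) fun k => ?_
    obtain ⟨j, hj, hlt⟩ := (hrep k).exists_gt (F.sup id)
    have hsub : F ⊆ Finset.range j := fun n hn =>
      Finset.mem_range.2 ((Finset.le_sup (f := id) hn).trans_lt hlt)
    rw [← show α j = α k from hj, heval,
      Real.norm_of_nonneg (Finset.sum_nonneg fun n _ => hg' n (α j))]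
    calc ∑ n ∈ F, g n (α j)
        = ∑ n ∈ F, A.indicator (fun i => (g i) (α j)) n :=
          Finset.sum_congr rfl fun n hn => (Set.indicator_of_mem (hF hn) (fun i => g i (α j))).symm
      _ ≤ ∑ n ∈ Finset.range j, A.indicator (fun i => (g i) (α j)) n :=
          Finset.sum_le_sum_of_subset_of_nonneg hsub fun n _ _ =>
            Set.indicator_nonneg (fun i _ => hg' i (α j)) n
      _ ≤ C := hC j
end

section
/- Let K be a compact metric space, g = (g_n)_{n∈ℕ} a sequence of non-negative functions in C(K, ℝ), and α : ℕ → K a sequence whose range is dense in K and such that for every k the set {j ∈ ℕ : α_j = α_k} is infinite. For k ∈ ℕ and A ⊆ ℕ set μ_k(A) := Σ_{n∈A, n<k} g_n(α_k). Then for every A ⊆ ℕ: the family (g_n)_{n∈A} is summable in C(K, ℝ) (i.e. A ∈ C(g)) if and only if for every ε > 0 there exists N ∈ ℕ such that μ_k(A \ {0, …, N}) ≤ ε for every k ∈ ℕ. -/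
theorem stmt8 {K : Type*} [MetricSpace K] [CompactSpace K]
    (g : ℕ → C(K, ℝ)) (hg : ∀ n, 0 ≤ g n)
    (α : ℕ → K) (hdense : DenseRange α)
    (hrep : ∀ k, {j : ℕ | α j = α k}.Infinite) :
    ∀ A : Set ℕ,
      A ∈ CIdeal g ↔
        ∀ ε : ℝ, 0 < ε → ∃ N : ℕ, ∀ k : ℕ,
          ∑ n ∈ Finset.range k,
            (A \ {m : ℕ | m ≤ N}).indicator (fun i => (g i) (α k)) n ≤ ε := by
  classical
  intro A
  have hA : A ∈ CIdeal g ↔ Summable (A.indicator g) :=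
    summable_subtype_iff_indicator (f := g)
  have happ : ∀ n x, A.indicator g n x = A.indicator (fun i => g i x) n := by
    intro n x
    by_cases hn : n ∈ A <;> simp [hn]
  have hnn : ∀ n x, 0 ≤ g n x := fun n x => hg n x
  rw [hA, summable_iff_vanishing_norm]
  constructor
  · intro h ε hε
    obtain ⟨s, hs⟩ := h ε hε
    refine ⟨s.sup id, fun k => ?_⟩
    have hdisj : Disjoint ((Finset.range k).filter fun n => ¬ n ≤ s.sup id) s := by
      rw [Finset.disjoint_left]
      intro n hn hns
      exact (Finset.mem_filter.mp hn).2 (Finset.le_sup (f := id) hns)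
    calc ∑ n ∈ Finset.range k,
            (A \ {m : ℕ | m ≤ s.sup id}).indicator (fun i => (g i) (α k)) n
        = (∑ n ∈ (Finset.range k).filter fun n => ¬ n ≤ s.sup id, A.indicator g n) (α k) := by
          rw [ContinuousMap.sum_apply, Finset.sum_filter]
          refine Finset.sum_congr rfl fun n _ => ?_
          rw [happ]
          simp only [Set.indicator_apply, Set.mem_sdiff, Set.mem_ofPred_eq]
          split_ifs <;> tauto
      _ ≤ ‖∑ n ∈ (Finset.range k).filter fun n => ¬ n ≤ s.sup id, A.indicator g n‖ :=
          (Real.le_norm_self _).trans (ContinuousMap.norm_coe_le_norm _ _)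
      _ ≤ ε := (hs _ hdisj).le
  · intro h ε hε
    obtain ⟨N, hN⟩ := h (ε / 2) (half_pos hε)
    refine ⟨Finset.range (N + 1), fun t ht => lt_of_le_of_lt ?_ (half_lt_self hε)⟩
    rw [ContinuousMap.norm_le _ (half_pos hε).le]
    intro x
    refine hdense.induction_on (p := fun x => ‖(∑ n ∈ t, A.indicator g n) x‖ ≤ ε / 2) x ?_ ?_
    · exact isClosed_le (by fun_prop) continuous_const
    · intro k
      obtain ⟨j, hj, hjt⟩ := (hrep k).exists_gt (t.sup id)
      rw [← show α j = α k from hj, ContinuousMap.sum_apply, Real.norm_of_nonneg]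
      · refine le_trans ?_ (hN j)
        calc ∑ n ∈ t, A.indicator g n (α j)
            = ∑ n ∈ t, (A \ {m : ℕ | m ≤ N}).indicator (fun i => (g i) (α j)) n := by
              refine Finset.sum_congr rfl fun n hn => ?_
              have hnN : ¬ n ≤ N := fun hle =>
                Finset.disjoint_left.mp ht hn (Finset.mem_range.mpr (Nat.lt_succ_of_le hle))
              rw [happ]
              simp [Set.indicator_apply, hnN]
          _ ≤ _ := by
              refine Finset.sum_le_sum_of_subset_of_nonneg (fun n hn => ?_) fun n _ _ =>
                Set.indicator_nonneg (fun i _ => hnn i _) n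
              exact Finset.mem_range.mpr ((Finset.le_sup (f := id) hn).trans_lt hjt)
      · refine Finset.sum_nonneg fun n _ => ?_
        rw [happ]
        exact Set.indicator_nonneg (fun i _ => hnn i _) n
end

section
/- Let (m_k)_{k∈ℕ} be a sequence of functions m_k : ℕ → [0, ∞) such that sup_k m_k(n) < ∞ for every n; for A ⊆ ℕ set μ_k(A) := Σ_{n∈A} m_k(n) ∈ [0, ∞] and φ(A) := sup_k μ_k(A). Then there exist functions l_k : ℕ → [0, ∞) with l_k(n) ≤ m_k(n) for all k, n, such that: (i) for every n the set {l_k(n) : k ∈ ℕ} is finite; and, setting λ_k(A) := Σ_{n∈A} l_k(n) and ψ(A) := sup_k λ_k(A), (ii) for every A ⊆ ℕ, φ(A) < ∞ if and only if ψ(A) < ∞; and (iii) for every A ⊆ ℕ, (for every ε > 0 there is N with φ(A \ {0, …, N}) ≤ ε) if and only if (for every ε > 0 there is N with ψ(A \ {0, …, N}) ≤ ε). -/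
open scoped ENNReal NNReal

/-- The non-pathological lower semicontinuous submeasure `sup_k μ_k` associated to a
sequence of (discrete) measures given by weight functions `m k : ℕ → [0,∞)`;
`phi m A = sup_k ∑_{n ∈ A} m k n`, computed in `[0,∞]`. -/
noncomputable def phi (m : ℕ → ℕ → ℝ≥0) (A : Set ℕ) : ℝ≥0∞ :=
  ⨆ k : ℕ, ∑' n : A, (m k n : ℝ≥0∞)

theorem phi_mono_left {l m : ℕ → ℕ → ℝ≥0} (h : ∀ k n, l k n ≤ m k n) (A : Set ℕ) :
    phi l A ≤ phi m A :=
  iSup_mono fun k => ENNReal.tsum_le_tsum fun n => ENNReal.coe_le_coe.2 (h k n)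

theorem phi_mono_right (m : ℕ → ℕ → ℝ≥0) {A B : Set ℕ} (h : A ⊆ B) : phi m A ≤ phi m B :=
  iSup_mono fun k => ENNReal.tsum_mono_subtype (fun n => (m k n : ℝ≥0∞)) h

theorem phi_le_phi_add_tsum {l m : ℕ → ℕ → ℝ≥0} {δ : ℕ → ℝ≥0}
    (h : ∀ k n, m k n ≤ l k n + δ n) (A : Set ℕ) :
    phi m A ≤ phi l A + ∑' n : A, (δ n : ℝ≥0∞) := by
  refine iSup_le fun k => ?_
  calc ∑' n : A, (m k n : ℝ≥0∞) ≤ ∑' n : A, ((l k n : ℝ≥0∞) + δ n) :=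
        ENNReal.tsum_le_tsum fun n => by exact_mod_cast h k n
    _ = ∑' n : A, (l k n : ℝ≥0∞) + ∑' n : A, (δ n : ℝ≥0∞) := ENNReal.tsum_add
    _ ≤ _ := add_le_add_left (le_iSup (fun k => ∑' n : A, (l k n : ℝ≥0∞)) k) _

theorem exists_tsum_diff_le {f : ℕ → ℝ≥0∞} (hf : ∑' n, f n ≠ ⊤) (A : Set ℕ) {ε : ℝ≥0∞}
    (hε : 0 < ε) : ∃ N : ℕ, ∑' n : ↥(A \ {i : ℕ | i ≤ N}), f n ≤ ε := by
  obtain ⟨s, hs⟩ := ((ENNReal.tendsto_tsum_compl_atTop_zero hf).eventually_le_const hε).exists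
  refine ⟨s.sup id, le_trans (ENNReal.tsum_mono_subtype f fun n hn => ?_) hs⟩
  exact fun hns => hn.2 (Finset.le_sup (f := id) hns)

theorem finite_range_floor_div {ι : Type*} {f : ι → ℝ≥0} (hf : (⨆ i, (f i : ℝ≥0∞)) < ⊤)
    (c : ℝ≥0) : (Set.range fun i => (⌊f i * c⌋₊ : ℝ≥0) / c).Finite := by
  obtain ⟨B, hB⟩ := WithTop.ne_top_iff_exists.1 hf.ne
  refine ((Set.finite_Iic ⌊B * c⌋₊).image fun j : ℕ => (j : ℝ≥0) / c).subset ?_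
  rintro _ ⟨i, rfl⟩
  refine ⟨⌊f i * c⌋₊, Nat.floor_mono ?_, rfl⟩
  have hi : f i ≤ B := ENNReal.coe_le_coe.1 ((le_iSup (fun i => (f i : ℝ≥0∞)) i).trans hB.ge)
  gcongr

theorem stmt9 (m : ℕ → ℕ → ℝ≥0) (hbdd : ∀ n : ℕ, (⨆ k : ℕ, (m k n : ℝ≥0∞)) < ⊤) :
    ∃ l : ℕ → ℕ → ℝ≥0,
      (∀ k n, l k n ≤ m k n) ∧
      (∀ n : ℕ, (Set.range fun k => l k n).Finite) ∧
      (∀ A : Set ℕ, phi m A < ⊤ ↔ phi l A < ⊤) ∧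
      (∀ A : Set ℕ,
        (∀ ε : ℝ≥0∞, 0 < ε → ∃ N : ℕ, phi m (A \ {i : ℕ | i ≤ N}) ≤ ε) ↔
        (∀ ε : ℝ≥0∞, 0 < ε → ∃ N : ℕ, phi l (A \ {i : ℕ | i ≤ N}) ≤ ε)) := by
  obtain ⟨δ, hδ, hsum⟩ := ENNReal.exists_pos_sum_of_countable one_ne_zero ℕ
  have hδsum : ∑' n, (δ n : ℝ≥0∞) ≠ ⊤ := hsum.ne_top
  let l : ℕ → ℕ → ℝ≥0 := fun k n => (⌊m k n * (δ n)⁻¹⌋₊ : ℝ≥0) / (δ n)⁻¹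
  have hle : ∀ k n, l k n ≤ m k n := fun k n =>
    (div_le_iff₀ (inv_pos.2 (hδ n))).2 (Nat.floor_le zero_le)
  have hge : ∀ k n, m k n ≤ l k n + δ n := fun k n => by
    have h := (Nat.lt_floor_add_one (m k n * (δ n)⁻¹)).le
    rw [← div_eq_mul_inv, div_le_iff₀ (hδ n)] at h
    simpa [l, add_mul, div_eq_mul_inv] using h
  refine ⟨l, hle, fun n => finite_range_floor_div (hbdd n) _, fun A => ⟨fun h => ?_, fun h => ?_⟩,
    fun A => ⟨fun h ε hε => ?_, fun h ε hε => ?_⟩⟩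
  · exact (phi_mono_left hle A).trans_lt h
  · refine (phi_le_phi_add_tsum hge A).trans_lt (ENNReal.add_lt_top.2 ⟨h, ?_⟩)
    exact (ENNReal.tsum_comp_le_tsum_of_injective Subtype.val_injective _).trans_lt
      hδsum.lt_top
  · exact (h ε hε).imp fun N hN => (phi_mono_left hle _).trans hN
  · obtain ⟨N, hN⟩ := h (ε / 2) (ENNReal.half_pos hε.ne')
    obtain ⟨M, hM⟩ := exists_tsum_diff_le hδsum A (ENNReal.half_pos hε.ne')
    have hsub : ∀ K ≤ max N M, A \ {i : ℕ | i ≤ max N M} ⊆ A \ {i : ℕ | i ≤ K} :=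
      fun K hK => Set.sdiff_subset_sdiff_right fun i hi => le_trans hi hK
    refine ⟨max N M, (phi_le_phi_add_tsum hge _).trans ?_⟩
    rw [← ENNReal.add_halves ε]
    exact add_le_add ((phi_mono_right l (hsub N (le_max_left _ _))).trans hN)
      ((ENNReal.tsum_mono_subtype (fun n => (δ n : ℝ≥0∞)) (hsub M (le_max_right _ _))).trans hM)
end

section
/- Let (m_k)_{k∈ℕ} be a sequence of functions m_k : ℕ → [0, ∞) such that for every n the set {m_k(n) : k ∈ ℕ} is finite. Then there exists a sequence (h_n)_{n∈ℕ} of non-negative continuous real-valued functions on the Cantor space 2^ℕ (the space of functions ℕ → {0,1} with the product topology) such that for every finite F ⊆ ℕ, ‖Σ_{n∈F} h_n‖_∞ = sup_{k∈ℕ} Σ_{n∈F} m_k(n), where ‖·‖_∞ is the supremum norm on C(2^ℕ, ℝ). -/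
/-- A nonempty compact subset of a metrizable space is the range of a continuous map from the
Cantor space. -/
theorem IsCompact.exists_nat_bool_range_eq {X : Type*} [TopologicalSpace X]
    [TopologicalSpace.MetrizableSpace X] {K : Set X} (hK : IsCompact K) (hne : K.Nonempty) :
    ∃ g : C((ℕ → Bool), X), Set.range g = K := by
  have : CompactSpace K := isCompact_iff_compactSpace.mp hK
  have : Nonempty K := hne.to_subtype
  let := TopologicalSpace.metrizableSpaceMetric K
  obtain ⟨g, hg, hsurj⟩ := exists_nat_bool_continuous_surjective_of_compact K
  refine ⟨⟨fun x => (g x : X), continuous_subtype_val.comp hg⟩, ?_⟩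
  change Set.range (Subtype.val ∘ g) = K
  rw [hsurj.range_comp, Subtype.range_coe]

theorem stmt10 (m : ℕ → ℕ → ℝ) (hpos : ∀ k n, 0 ≤ m k n)
    (hfin : ∀ n : ℕ, (Set.range fun k => m k n).Finite) :
    ∃ h : ℕ → C((ℕ → Bool), ℝ),
      (∀ n, 0 ≤ h n) ∧
      ∀ F : Finset ℕ, ‖∑ n ∈ F, h n‖ = ⨆ k : ℕ, ∑ n ∈ F, m k n := by
  have hcompact : IsCompact (closure (Set.range m)) :=
    (isCompact_univ_pi fun n => (hfin n).isCompact).closure_of_subset <| by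
      rintro _ ⟨k, rfl⟩ n -
      exact ⟨k, rfl⟩
  obtain ⟨g, hg⟩ := hcompact.exists_nat_bool_range_eq (Set.range_nonempty m).closure
  have hmem (x : ℕ → Bool) : g x ∈ closure (Set.range m) := hg ▸ Set.mem_range_self x
  have hnonneg (x : ℕ → Bool) (n : ℕ) : 0 ≤ g x n := by
    have hsub : closure (Set.range m) ⊆ {y | 0 ≤ y n} :=
      closure_minimal (by rintro _ ⟨k, rfl⟩; exact hpos k n)
        (isClosed_le continuous_const (continuous_apply n))
    exact hsub (hmem x)
  refine ⟨fun n => ⟨fun x => g x n, (continuous_apply n).comp g.continuous⟩,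
    fun n x => hnonneg x n, fun F => ?_⟩
  have hcont : Continuous fun y : ℕ → ℝ => ∑ n ∈ F, y n := by fun_prop
  have hbdd : BddAbove (Set.range fun k => ∑ n ∈ F, m k n) := by
    refine (hcompact.image hcont).bddAbove.mono ?_
    rintro _ ⟨k, rfl⟩
    exact ⟨m k, subset_closure ⟨k, rfl⟩, rfl⟩
  apply le_antisymm
  · refine (ContinuousMap.norm_le _
      (Real.iSup_nonneg fun k => Finset.sum_nonneg fun n _ => hpos k n)).mpr fun x => ?_
    have hsub : closure (Set.range m) ⊆ {y | ∑ n ∈ F, y n ≤ ⨆ k : ℕ, ∑ n ∈ F, m k n} :=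
      closure_minimal (by rintro _ ⟨k, rfl⟩; exact le_ciSup hbdd k)
        (isClosed_le hcont continuous_const)
    simp only [ContinuousMap.sum_apply, ContinuousMap.coe_mk]
    rw [Real.norm_of_nonneg (Finset.sum_nonneg fun n _ => hnonneg x n)]
    exact hsub (hmem x)
  · refine ciSup_le fun k => ?_
    obtain ⟨x, hx⟩ : m k ∈ Set.range g := hg ▸ subset_closure ⟨k, rfl⟩
    refine le_trans ?_ ((Real.le_norm_self _).trans (ContinuousMap.norm_coe_le_norm _ x))
    simp [ContinuousMap.sum_apply, hx]
end

section
/- Let I be a collection of subsets of ℕ that contains all finite sets, is closed under taking subsets and finite unions, is tall, and, viewed as a subset of the Cantor space 2^ℕ via characteristic functions, is a countable union of closed sets (F_σ). Then there exists a family 𝓕 of finite subsets of ℕ such that: (a) no infinite Y ⊆ ℕ has the property that every infinite P ⊆ Y has an initial segment belonging to 𝓕 (where a finite set s is an initial segment of P if s = P ∩ {0, …, n} for some n); and (b) I is exactly the collection of sets A ⊆ ℕ that can be written as a finite union A = X_1 ∪ … ∪ X_m of sets X_i ⊆ ℕ, each of which has no finite subset belonging to 𝓕. -/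
open scoped Classical

/-- The characteristic function of a subset of `ℕ`, as a point of the Cantor space. -/
noncomputable def chi (A : Set ℕ) : ℕ → Bool :=
  fun n => if n ∈ A then true else false

/-- `s` is an initial segment of `P`: `s = P ∩ {0, …, n}` for some `n`. -/
def IsInitSeg (s : Finset ℕ) (P : Set ℕ) : Prop :=
  ∃ n : ℕ, (↑s : Set ℕ) = P ∩ {i : ℕ | i ≤ n}

/-- The finite sets of at least two elements which, for some element `n`, are not contained in
any set coded by a point of `S 0 ∪ … ∪ S n`. -/
def uncoveredFinsets (S : ℕ → Set (ℕ → Bool)) : Set (Finset ℕ) :=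
  {s | s.Nontrivial ∧ ∃ n ∈ s, ∀ i ≤ n, ∀ f ∈ S i, ∃ j ∈ s, f j = false}

theorem chi_eq_true_iff {A : Set ℕ} {n : ℕ} : chi A n = true ↔ n ∈ A := by
  simp [chi]

/-- An infinite set without uncovered finite subsets is contained in a set coded by some `S i`. -/
theorem exists_cover_of_infinite {S : ℕ → Set (ℕ → Bool)} (hS : ∀ i, IsClosed (S i))
    {X : Set ℕ} (hX : X.Infinite)
    (h : ∀ s : Finset ℕ, (↑s : Set ℕ) ⊆ X → s ∉ uncoveredFinsets S) :
    ∃ i, ∃ f ∈ S i, ∀ x ∈ X, f x = true := by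
  obtain ⟨n, hn, m, hm, hnm⟩ := hX.nontrivial
  have hK : IsCompact (⋃ i ∈ Set.Iic n, S i) :=
    ((Set.finite_Iic n).isClosed_biUnion fun i _ => hS i).isCompact
  have hne : ((⋃ i ∈ Set.Iic n, S i) ∩ ⋂ x : X, {f : ℕ → Bool | f x = true}).Nonempty := by
    refine hK.inter_iInter_nonempty _
      (fun x => isClosed_eq (continuous_apply _) continuous_const) fun u => ?_
    set s : Finset ℕ := insert n (insert m (u.image Subtype.val)) with hs
    have hsX : (↑s : Set ℕ) ⊆ X := by
      intro x hx
      simp only [hs, Finset.mem_coe, Finset.mem_insert, Finset.mem_image] at hx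
      rcases hx with rfl | rfl | ⟨y, -, rfl⟩
      exacts [hn, hm, y.2]
    have hcov := h s hsX
    have hnt : s.Nontrivial := ⟨n, by simp [hs], m, by simp [hs], hnm⟩
    simp only [uncoveredFinsets, Set.mem_ofPred_eq, not_and, not_exists] at hcov
    have hcov := hcov hnt n (by simp [hs])
    push Not at hcov
    obtain ⟨i, hi, f, hf, hfs⟩ := hcov
    refine ⟨f, Set.mem_biUnion (Set.mem_Iic.2 hi) hf, ?_⟩
    simp only [Set.mem_iInter, Set.mem_ofPred_eq]
    intro x hx
    have hxs : (x : ℕ) ∈ s := by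
      simp only [hs, Finset.mem_insert, Finset.mem_image]
      exact Or.inr (Or.inr ⟨x, hx, rfl⟩)
    simpa using hfs x hxs
  obtain ⟨f, hf, hfX⟩ := hne
  obtain ⟨i, -, hi⟩ := Set.mem_iUnion₂.1 hf
  exact ⟨i, f, hi, fun x hx => Set.mem_iInter.1 hfX ⟨x, hx⟩⟩

/-- A set coded by a point of `S n` is a finite union of sets without uncovered finite subsets. -/
theorem exists_decomposition {S : ℕ → Set (ℕ → Bool)} {A : Set ℕ} {n : ℕ} (hA : chi A ∈ S n) :
    ∃ (m : ℕ) (X : Fin m → Set ℕ), A = ⋃ j, X j ∧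
      ∀ j, ∀ s : Finset ℕ, (↑s : Set ℕ) ⊆ X j → s ∉ uncoveredFinsets S := by
  refine ⟨n + 1, Fin.cases (A ∩ Set.Ici n) fun k => A ∩ {(k : ℕ)}, ?_, fun j => ?_⟩
  · ext x
    simp only [Set.mem_iUnion, Fin.exists_fin_succ, Fin.cases_zero, Fin.cases_succ, Set.mem_inter_iff,
      Set.mem_Ici, Set.mem_singleton_iff]
    constructor
    · intro hx
      rcases le_or_gt n x with h | h
      exacts [Or.inl ⟨hx, h⟩, Or.inr ⟨⟨x, h⟩, hx, rfl⟩]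
    · rintro (h | ⟨_, h⟩) <;> exact h.1
  · cases j using Fin.cases with
    | zero =>
      rintro s hs ⟨-, k, hk, h⟩
      obtain ⟨j, hj, hfalse⟩ := h n (hs hk).2 _ hA
      simp [chi_eq_true_iff.2 (hs hj).1] at hfalse
    | succ k =>
      rintro s hs ⟨⟨x, hx, y, hy, hxy⟩, -⟩
      exact hxy ((hs hx).2.trans (hs hy).2.symm)

theorem stmt11 (I : Set (Set ℕ))
    (hfin : ∀ A : Set ℕ, A.Finite → A ∈ I)
    (hdown : ∀ A B : Set ℕ, A ⊆ B → B ∈ I → A ∈ I)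
    (hunion : ∀ A B : Set ℕ, A ∈ I → B ∈ I → A ∪ B ∈ I)
    (htall : Tall I)
    (hFsigma : ∃ S : ℕ → Set (ℕ → Bool), (∀ i, IsClosed (S i)) ∧ chi '' I = ⋃ i, S i) :
    ∃ 𝓕 : Set (Finset ℕ),
      (¬ ∃ Y : Set ℕ, Y.Infinite ∧
          ∀ P : Set ℕ, P ⊆ Y → P.Infinite → ∃ s ∈ 𝓕, IsInitSeg s P) ∧
      (I = {A : Set ℕ | ∃ (m : ℕ) (X : Fin m → Set ℕ),
        A = ⋃ j, X j ∧ ∀ j, ∀ s : Finset ℕ, (↑s : Set ℕ) ⊆ X j → s ∉ 𝓕}) := by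
  obtain ⟨S, hS, hIS⟩ := hFsigma
  have hmem : ∀ X : Set ℕ,
      (∀ s : Finset ℕ, (↑s : Set ℕ) ⊆ X → s ∉ uncoveredFinsets S) → X ∈ I := by
    intro X hX
    by_cases hXfin : X.Finite
    · exact hfin X hXfin
    · obtain ⟨i, f, hf, hfX⟩ := exists_cover_of_infinite hS hXfin hX
      obtain ⟨B, hB, rfl⟩ : f ∈ chi '' I := hIS ▸ Set.mem_iUnion.2 ⟨i, hf⟩
      exact hdown X B (fun x hx => chi_eq_true_iff.1 (hfX x hx)) hB
  have hdecomp : ∀ A ∈ I, ∃ (m : ℕ) (X : Fin m → Set ℕ), A = ⋃ j, X j ∧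
      ∀ j, ∀ s : Finset ℕ, (↑s : Set ℕ) ⊆ X j → s ∉ uncoveredFinsets S := by
    intro A hA
    have hchi : chi A ∈ ⋃ i, S i := hIS ▸ Set.mem_image_of_mem chi hA
    obtain ⟨n, hn⟩ := Set.mem_iUnion.1 hchi
    exact exists_decomposition hn
  refine ⟨uncoveredFinsets S, ?_, Set.Subset.antisymm hdecomp ?_⟩
  · rintro ⟨Y, hY, hYP⟩
    obtain ⟨B, hBY, hBinf, hBI⟩ := htall Y hY
    obtain ⟨m, X, rfl, hX⟩ := hdecomp B hBI
    obtain ⟨j, hj⟩ : ∃ j, (X j).Infinite := by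
      by_contra! h
      exact hBinf (Set.finite_iUnion fun j => by simpa using h j)
    obtain ⟨s, hs, n, hsn⟩ := hYP (X j) ((Set.subset_iUnion X j).trans hBY) hj
    exact hX j s (hsn.subset.trans Set.inter_subset_left) hs
  · rintro _ ⟨m, X, rfl, hX⟩
    have hfinset : ∀ t : Finset (Fin m), ⋃ j ∈ t, X j ∈ I := by
      intro t
      induction t using Finset.induction_on with
      | empty => simpa using hfin ∅ Set.finite_empty
      | insert j t _ ih =>
        rw [Finset.set_biUnion_insert]
        exact hunion _ _ (hmem _ (hX j)) ih
    simpa using hfinset Finset.univ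
end

section
/- For every integer p ≥ 2, every real δ > 0, and every r ≥ 1 there exists N ∈ ℕ such that for every n ≥ N the following holds: for every coloring with r colors of the family S_{δ,p}(n) := {A ⊆ {0, …, n−1} : (1−δ)·n/p ≤ |A| ≤ (1+δ)·n/p}, there exist p+1 pairwise distinct sets A_0, …, A_p ∈ S_{δ,p}(n), all of the same color, with A_0 ∪ ⋯ ∪ A_p = {0, …, n−1}. -/
/-- A function on `G ^ n` that changes by at most `1` when a single coordinate changes has variance
at most `n`. -/
theorem exists_sum_sq_sub_le {G : Type*} [Fintype G] [Nonempty G] :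
    ∀ (n : ℕ) (f : (Fin n → G) → ℝ), (∀ w x a, |f (Function.update w x a) - f w| ≤ 1) →
      ∃ c : ℝ, ∑ w, (f w - c) ^ 2 ≤ n * (Fintype.card G : ℝ) ^ n := by
  intro n
  induction n with
  | zero =>
    intro f _
    exact ⟨f default, by simp⟩
  | succ n ih =>
    intro f hf
    have hP : (0 : ℝ) < Fintype.card G := by exact_mod_cast Fintype.card_pos
    set P : ℝ := (Fintype.card G : ℝ) with hPdef
    have hcons : ∀ (u : Fin n → G) (a b : G),
        |f (Fin.cons a u : Fin (n + 1) → G) - f (Fin.cons b u : Fin (n + 1) → G)| ≤ 1 := by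
      intro u a b
      have := hf (Fin.cons b u : Fin (n + 1) → G) 0 a
      rwa [Fin.update_cons_zero] at this
    let H : (Fin n → G) → ℝ := fun u => (∑ a, f (Fin.cons a u : Fin (n + 1) → G)) / P
    have hH : ∀ u, ∑ a, f (Fin.cons a u : Fin (n + 1) → G) = P * H u := by
      intro u
      simp only [H]
      field_simp
    have avg : ∀ (g : G → ℝ), (∀ a, |g a| ≤ 1) → |(∑ a, g a) / P| ≤ 1 := by
      intro g hg
      rw [abs_div, abs_of_pos hP, div_le_one hP]
      calc |∑ a, g a| ≤ ∑ a, |g a| := Finset.abs_sum_le_sum_abs _ _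
        _ ≤ ∑ _a : G, (1 : ℝ) := Finset.sum_le_sum fun a _ => hg a
        _ = P := by simp [hPdef]
    obtain ⟨c, hc⟩ := ih H (by
      intro w x a
      simp only [H]
      rw [← sub_div, ← Finset.sum_sub_distrib]
      apply avg
      intro b
      rw [Fin.cons_update]
      exact hf _ _ _)
    refine ⟨c, ?_⟩
    have hdev : ∀ u a, (f (Fin.cons a u : Fin (n + 1) → G) - H u) ^ 2 ≤ 1 := by
      intro u a
      rw [sq_le_one_iff_abs_le_one]
      have h := avg (fun b => f (Fin.cons a u : Fin (n + 1) → G) -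
        f (Fin.cons b u : Fin (n + 1) → G)) (fun b => hcons u a b)
      rw [Finset.sum_sub_distrib, hH, sub_div, mul_div_cancel_left₀ _ hP.ne'] at h
      simpa [← hPdef, mul_div_cancel_left₀ _ hP.ne'] using h
    have hfiber : ∀ u, ∑ a, (f (Fin.cons a u : Fin (n + 1) → G) - c) ^ 2 ≤
        P + P * (H u - c) ^ 2 := by
      intro u
      have h1 : ∑ a, (f (Fin.cons a u : Fin (n + 1) → G) - c) ^ 2 =
          ∑ a, (f (Fin.cons a u : Fin (n + 1) → G) - H u) ^ 2 + P * (H u - c) ^ 2 := by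
        have h2 : ∀ a, (f (Fin.cons a u : Fin (n + 1) → G) - c) ^ 2 =
            (f (Fin.cons a u : Fin (n + 1) → G) - H u) ^ 2 +
              (2 * (H u - c) * f (Fin.cons a u : Fin (n + 1) → G) + (c ^ 2 - H u ^ 2)) := by
          intro a; ring
        simp only [h2, Finset.sum_add_distrib, ← Finset.mul_sum, hH]
        simp only [Finset.sum_const, Finset.card_univ, nsmul_eq_mul, ← hPdef]
        ring
      rw [h1]
      have : ∑ a, (f (Fin.cons a u : Fin (n + 1) → G) - H u) ^ 2 ≤ ∑ _a : G, (1 : ℝ) :=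
        Finset.sum_le_sum fun a _ => hdev u a
      simp only [Finset.sum_const, Finset.card_univ, nsmul_eq_mul, ← hPdef, mul_one] at this
      linarith
    calc ∑ w, (f w - c) ^ 2
        = ∑ u, ∑ a, (f (Fin.cons a u : Fin (n + 1) → G) - c) ^ 2 := by
          rw [← (Fin.consEquiv fun _ : Fin (n + 1) => G).sum_comp, Fintype.sum_prod_type_right]
          rfl
      _ ≤ ∑ u, (P + P * (H u - c) ^ 2) := Finset.sum_le_sum fun u _ => hfiber u
      _ = P ^ n * P + P * ∑ u, (H u - c) ^ 2 := by
          rw [Finset.sum_add_distrib, ← Finset.mul_sum]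
          simp [hPdef]
      _ ≤ P ^ n * P + P * (n * P ^ n) := by gcongr
      _ = (n + 1 : ℕ) * P ^ (n + 1) := by push_cast; ring

/-- Finitely many functions on `G ^ n` that are `1`-Lipschitz in each coordinate are simultaneously
nearly constant along some orbit of the diagonal translation action of `G`. -/
theorem exists_forall_abs_sub_le {G ι : Type*} [Fintype G] [AddGroup G] [Fintype ι] {n E : ℕ}
    (f : ι → (Fin n → G) → ℝ) (hf : ∀ k w x a, |f k (Function.update w x a) - f k w| ≤ 1)
    (hE : Fintype.card ι * Fintype.card G * n < E ^ 2) :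
    ∃ (w : Fin n → G) (c : ι → ℝ), ∀ k g, |f k (fun x => w x + g) - c k| ≤ E := by
  choose c hc using fun k => exists_sum_sq_sub_le n (f k) (hf k)
  have hP : (0 : ℝ) < (Fintype.card G : ℝ) ^ n := by
    have : (0 : ℝ) < Fintype.card G := by exact_mod_cast Fintype.card_pos
    positivity
  have htotal : ∑ w : Fin n → G, ∑ k, ∑ g, (f k (fun x => w x + g) - c k) ^ 2 <
      ∑ _w : Fin n → G, (E : ℝ) ^ 2 := by
    rw [Finset.sum_comm]
    have hk : ∀ k, ∑ w : Fin n → G, ∑ g, (f k (fun x => w x + g) - c k) ^ 2 ≤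
        Fintype.card G * (n * (Fintype.card G : ℝ) ^ n) := by
      intro k
      rw [Finset.sum_comm]
      have hg : ∀ g : G, ∑ w : Fin n → G, (f k (fun x => w x + g) - c k) ^ 2 =
          ∑ w, (f k w - c k) ^ 2 := fun g =>
        Equiv.sum_comp (Equiv.addRight (fun _ : Fin n => g)) fun w => (f k w - c k) ^ 2
      simp only [hg, Finset.sum_const, Finset.card_univ, nsmul_eq_mul]
      gcongr
      exact hc k
    calc _ ≤ ∑ _k : ι, Fintype.card G * (n * (Fintype.card G : ℝ) ^ n) :=
          Finset.sum_le_sum fun k _ => hk k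
      _ = (Fintype.card ι * Fintype.card G * n : ℕ) * (Fintype.card G : ℝ) ^ n := by
          simp; ring
      _ < ((E ^ 2 : ℕ) : ℝ) * (Fintype.card G : ℝ) ^ n := by gcongr
      _ = _ := by simp; ring
  obtain ⟨w, -, hw⟩ := Finset.exists_lt_of_sum_lt htotal
  refine ⟨w, c, fun k g => abs_le_of_sq_le_sq ?_ (by positivity)⟩
  refine le_trans ?_ hw.le
  refine le_trans ?_ (Finset.single_le_sum (f := fun k => ∑ g, (f k (fun x => w x + g) - c k) ^ 2)
    (fun k _ => Finset.sum_nonneg fun g _ => sq_nonneg _) (Finset.mem_univ k))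
  exact Finset.single_le_sum (f := fun g => (f k (fun x => w x + g) - c k) ^ 2)
    (fun g _ => sq_nonneg _) (Finset.mem_univ g)

/-- The least number of elements of `B` left uncovered by a member of the family `R`. -/
noncomputable def uncovered {α : Type*} [DecidableEq α] (R : Set (Finset α)) (B : Finset α) : ℕ :=
  sInf {k | ∃ A ∈ R, (B \ A).card = k}

theorem uncovered_le_card {α : Type*} [DecidableEq α] {R : Set (Finset α)} {A : Finset α}
    (hA : A ∈ R) (B : Finset α) : uncovered R B ≤ (B \ A).card :=
  Nat.sInf_le ⟨A, hA, rfl⟩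

theorem exists_card_sdiff_eq_uncovered {α : Type*} [DecidableEq α] {R : Set (Finset α)}
    (hR : R.Nonempty) (B : Finset α) : ∃ A ∈ R, (B \ A).card = uncovered R B :=
  Nat.sInf_mem (s := {k | ∃ A ∈ R, (B \ A).card = k}) (hR.imp' _ fun A hA => ⟨A, hA, rfl⟩)

theorem uncovered_le_add_one {α : Type*} [DecidableEq α] (R : Set (Finset α)) {B B' : Finset α}
    {x : α} (h : B ⊆ insert x B') : uncovered R B ≤ uncovered R B' + 1 := by
  rcases R.eq_empty_or_nonempty with rfl | hR
  · simp [uncovered]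
  · obtain ⟨A, hA, hB'⟩ := exists_card_sdiff_eq_uncovered hR B'
    rw [← hB']
    calc uncovered R B ≤ (B \ A).card := uncovered_le_card hA B
      _ ≤ (insert x (B' \ A)).card := Finset.card_le_card fun y hy => by
          have := h (Finset.mem_sdiff.1 hy).1
          simp only [Finset.mem_sdiff, Finset.mem_insert] at *
          tauto
      _ ≤ _ := Finset.card_insert_le _ _

theorem abs_sub_le_one_of_update {n : ℕ} {G : Type*} [DecidableEq G] (z : G)
    (φ : Finset (Fin n) → ℕ) (hφ : ∀ B B' x, B ⊆ insert x B' → φ B ≤ φ B' + 1)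
    (w : Fin n → G) (x : Fin n) (a : G) :
    |((φ {y | Function.update w x a y = z} : ℕ) : ℝ) - (φ {y | w y = z} : ℕ)| ≤ 1 := by
  have h1 := hφ {y | Function.update w x a y = z} {y | w y = z} x (by
    intro y hy
    by_cases hyx : y = x <;> simp_all [Function.update_apply])
  have h2 := hφ {y | w y = z} {y | Function.update w x a y = z} x (by
    intro y hy
    by_cases hyx : y = x <;> simp_all [Function.update_apply])
  have h1' : ((φ {y | Function.update w x a y = z} : ℕ) : ℝ) ≤ (φ {y | w y = z} : ℕ) + 1 := by
    exact_mod_cast h1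
  have h2' : ((φ {y | w y = z} : ℕ) : ℝ) ≤ (φ {y | Function.update w x a y = z} : ℕ) + 1 := by
    exact_mod_cast h2
  rw [abs_le]
  constructor <;> linarith

/-- If the sets of size `m` are coloured, a set `B` of size at most `m - r * t` has a colour `i`
such that every enlargement of `B` by at most `t` elements lies in an `m`-set of colour `i`. -/
theorem exists_robust_color {n m t r : ℕ} (hmn : m ≤ n) (col : Finset (Fin n) → Fin r)
    {B : Finset (Fin n)} (hB : B.card + r * t ≤ m) :
    ∃ i, ∀ U : Finset (Fin n), U.card ≤ t → ∃ A, B ∪ U ⊆ A ∧ A.card = m ∧ col A = i := by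
  by_contra! h
  choose U hU hA using h
  have hcard : (B ∪ Finset.univ.biUnion U).card ≤ m := by
    have h1 : (Finset.univ.biUnion U).card ≤ Finset.univ.card * t :=
      Finset.card_biUnion_le_card_mul _ _ _ fun i _ => hU i
    rw [Finset.card_univ, Fintype.card_fin] at h1
    exact (Finset.card_union_le _ _).trans (by omega)
  obtain ⟨A, hsub, hAm⟩ := Finset.exists_superset_card_eq hcard (by simpa using hmn)
  refine hA (col A) A (subset_trans ?_ hsub) hAm rfl
  exact Finset.union_subset_union_right (Finset.subset_biUnion_of_mem U (Finset.mem_univ _))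

/-- In a colouring of the `m`-subsets of an `n`-set, where `m` exceeds `n / (p + 1)` by a suitable
margin, some `p + 1` sets of the same colour cover everything. -/
theorem exists_monochromatic_cover {n m p r E : ℕ} (hmn : m ≤ n)
    (hE : (r + 1) * (p + 1) * n < E ^ 2)
    (hm : n + (p + 1) * (2 * E + r * (2 * (p + 1) * E)) ≤ (p + 1) * m)
    (col : Finset (Fin n) → Fin r) :
    ∃ (i : Fin r) (A : Fin (p + 1) → Finset (Fin n)),
      (∀ j, (A j).card = m ∧ col (A j) = i) ∧ Finset.univ.biUnion A = Finset.univ := by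
  set t := 2 * (p + 1) * E with ht
  let R : Fin r → Set (Finset (Fin n)) := fun i =>
    {B | ∀ U : Finset (Fin n), U.card ≤ t → ∃ A, B ∪ U ⊆ A ∧ A.card = m ∧ col A = i}
  let φ : Option (Fin r) → Finset (Fin n) → ℕ := fun k => k.elim Finset.card fun i => uncovered (R i)
  have hφ : ∀ k B B' x, B ⊆ insert x B' → φ k B ≤ φ k B' + 1 := by
    rintro (_ | i) B B' x h
    · exact (Finset.card_le_card h).trans (Finset.card_insert_le _ _)
    · exact uncovered_le_add_one _ h
  obtain ⟨w, c, hwc⟩ := exists_forall_abs_sub_le (G := Fin (p + 1)) (E := E)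
    (fun k w => ((φ k {y | w y = 0} : ℕ) : ℝ))
    (fun k w x a => abs_sub_le_one_of_update 0 (φ k) (hφ k) w x a) (by simpa using hE)
  let B : Fin (p + 1) → Finset (Fin n) := fun g => {y | w y + g = 0}
  have hclose : ∀ k g g', φ k (B g) ≤ φ k (B g') + 2 * E := by
    intro k g g'
    have h1 := abs_le.1 (hwc k g)
    have h2 := abs_le.1 (hwc k g')
    have : (φ k (B g) : ℝ) ≤ φ k (B g') + 2 * E := by
      simp only [B]
      linarith [h1.2, h2.1]
    exact_mod_cast this
  have hsum : ∑ g, (B g).card = n := by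
    have h := Finset.card_eq_sum_card_fiberwise (s := (Finset.univ : Finset (Fin n)))
      (t := (Finset.univ : Finset (Fin (p + 1)))) (f := fun y => -w y) (by simp)
    rw [Finset.card_univ, Fintype.card_fin] at h
    refine Eq.trans ?_ h.symm
    refine Finset.sum_congr rfl fun g _ => congrArg _ ?_
    ext y
    simp [B, neg_eq_iff_add_eq_zero]
  have hsmall : (p + 1) * (B 0).card ≤ n + (p + 1) * (2 * E) := by
    have h : ∑ _g : Fin (p + 1), (B 0).card ≤ ∑ g, ((B g).card + 2 * E) :=
      Finset.sum_le_sum fun g _ => hclose none 0 g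
    simpa [Finset.sum_add_distrib, hsum] using h
  have hB0 : (B 0).card + r * t ≤ m := by
    refine Nat.le_of_mul_le_mul_left (?_ : (p + 1) * _ ≤ (p + 1) * m) p.succ_pos
    linarith
  obtain ⟨i, hi⟩ := exists_robust_color hmn col hB0
  have hRi : B 0 ∈ R i := hi
  have h0 : uncovered (R i) (B 0) = 0 := by
    simpa using uncovered_le_card hRi (B 0)
  choose A hAR hAB using fun g => exists_card_sdiff_eq_uncovered ⟨_, hRi⟩ (B g)
  have hunc : ∀ g, (B g \ A g).card ≤ 2 * E := by
    intro g
    have h := hclose (some i) g 0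
    change uncovered (R i) (B g) ≤ uncovered (R i) (B 0) + 2 * E at h
    rw [hAB]
    omega
  let U : Finset (Fin n) := Finset.univ.biUnion fun g => B g \ A g
  have hU : U.card ≤ t := by
    have h := Finset.card_biUnion_le_card_mul Finset.univ (fun g => B g \ A g) (2 * E)
      fun g _ => hunc g
    rw [Finset.card_univ, Fintype.card_fin] at h
    refine h.trans (le_of_eq ?_)
    rw [ht]; ring
  choose A' hsub hcard hcol using fun g => hAR g U hU
  refine ⟨i, A', fun j => ⟨hcard j, hcol j⟩, Finset.eq_univ_of_forall fun y => ?_⟩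
  have hy : y ∈ B (-w y) := by simp [B]
  rw [Finset.mem_biUnion]
  refine ⟨-w y, Finset.mem_univ _, hsub _ ?_⟩
  by_cases hyA : y ∈ A (-w y)
  · exact Finset.mem_union_left _ hyA
  · exact Finset.mem_union_right _
      (Finset.mem_biUnion.2 ⟨_, Finset.mem_univ _, Finset.mem_sdiff.2 ⟨hy, hyA⟩⟩)

/-- `p + 1` sets of size `m` whose union has more than `p * m` elements are pairwise distinct. -/
theorem injective_of_mul_lt_card_biUnion {α : Type*} [DecidableEq α] {p m : ℕ}
    {A : Fin (p + 1) → Finset α} (hA : ∀ j, (A j).card = m)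
    (h : p * m < (Finset.univ.biUnion A).card) : Function.Injective A := by
  intro j k hjk
  by_contra hne
  have hsub : Finset.univ.biUnion A ⊆ (Finset.univ.erase j).biUnion A := by
    intro y hy
    obtain ⟨l, -, hl⟩ := Finset.mem_biUnion.1 hy
    rw [Finset.mem_biUnion]
    by_cases hlj : l = j
    · exact ⟨k, by simp [Ne.symm hne], by rwa [← hjk, ← hlj]⟩
    · exact ⟨l, by simp [hlj], hl⟩
  have hle := Finset.card_biUnion_le_card_mul (Finset.univ.erase j) A m fun l _ => (hA l).le
  rw [Finset.card_erase_of_mem (Finset.mem_univ j), Finset.card_univ, Fintype.card_fin,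
    Nat.add_sub_cancel] at hle
  exact absurd (h.trans_le ((Finset.card_le_card hsub).trans hle)) (lt_irrefl _)

theorem stmt14 (p : ℕ) (hp : 2 ≤ p) (δ : ℝ) (hδ : 0 < δ) (r : ℕ) (hr : 1 ≤ r) :
    ∃ N : ℕ, ∀ n : ℕ, N ≤ n →
      ∀ col : Finset ℕ → Fin r,
        ∃ A : Fin (p + 1) → Finset ℕ,
          Function.Injective A ∧
          (∀ j, A j ⊆ Finset.range n ∧
            (1 - δ) * (n : ℝ) / (p : ℝ) ≤ ((A j).card : ℝ) ∧
            ((A j).card : ℝ) ≤ (1 + δ) * (n : ℝ) / (p : ℝ)) ∧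
          (∀ j k, col (A j) = col (A k)) ∧
          Finset.univ.biUnion A = Finset.range n := by
  obtain ⟨D, hD⟩ : ∃ D, D = p * (p + 1) * (4 + 2 * r * (p + 1)) := ⟨_, rfl⟩
  have hDpos : 0 < D := by rw [hD]; positivity
  obtain ⟨M, hM⟩ := exists_nat_ge (p / δ)
  refine ⟨M + D * (2 * D * ((r + 1) * (p + 1)) + 1), fun n hn col => ?_⟩
  obtain ⟨E, hEdef⟩ : ∃ E, E = n / D := ⟨_, rfl⟩
  have hE1 : 2 * D * ((r + 1) * (p + 1)) + 1 ≤ E := by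
    rw [hEdef, Nat.le_div_iff_mul_le hDpos]
    linarith
  have hE2 : D * E ≤ n := by rw [hEdef]; exact Nat.mul_div_le n D
  have hE3 : n < D * (E + 1) := by
    rw [hEdef]
    exact Nat.lt_mul_div_succ n hDpos
  have hnpos : 0 < n := by
    have : 0 < D * E := Nat.mul_pos hDpos (by omega)
    omega
  obtain ⟨m, hmdef⟩ : ∃ m, m = (n - 1) / p := ⟨_, rfl⟩
  have hpm : p * m < n := by
    have : p * m ≤ n - 1 := by rw [hmdef]; exact Nat.mul_div_le _ _
    omega
  have hpm' : n ≤ p * (m + 1) := by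
    have : n - 1 < p * (m + 1) := by
      rw [hmdef]
      exact Nat.lt_mul_div_succ _ (by omega)
    omega
  have hmn : m ≤ n := by nlinarith
  have hEsq : (r + 1) * (p + 1) * n < E ^ 2 := by
    have hn2 : n ≤ 2 * D * E := by
      have : D ≤ D * E := Nat.le_mul_of_pos_right _ (by omega)
      linarith
    calc (r + 1) * (p + 1) * n ≤ (r + 1) * (p + 1) * (2 * D * E) := Nat.mul_le_mul_left _ hn2
      _ = (2 * D * ((r + 1) * (p + 1))) * E := by ring
      _ < E * E := Nat.mul_lt_mul_of_pos_right (by omega) (by omega)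
      _ = E ^ 2 := by ring
  have hm : n + (p + 1) * (2 * E + r * (2 * (p + 1) * E)) ≤ (p + 1) * m := by
    refine Nat.le_of_mul_le_mul_left (?_ : p * _ ≤ p * _) (by omega : 0 < p)
    have h1 : D * E = p * ((p + 1) * (2 * E + r * (2 * (p + 1) * E))) + 2 * p * (p + 1) * E := by
      rw [hD]; ring
    have h2 : p * (p + 1) ≤ 2 * p * (p + 1) * E := by
      calc p * (p + 1) ≤ p * (p + 1) * (2 * E) := Nat.le_mul_of_pos_right _ (by omega)
        _ = 2 * p * (p + 1) * E := by ring
    have h3 : (p + 1) * n ≤ (p + 1) * (p * (m + 1)) := Nat.mul_le_mul_left _ hpm'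
    linarith
  obtain ⟨i, A, hA, hcover⟩ := exists_monochromatic_cover hmn hEsq hm
    fun B => col (B.map Fin.valEmbedding)
  have hunion : Finset.univ.biUnion (fun j => (A j).map Fin.valEmbedding) = Finset.range n := by
    ext y
    simp only [Finset.mem_biUnion, Finset.mem_univ, true_and, Finset.mem_map, Finset.mem_range]
    constructor
    · rintro ⟨j, x, -, rfl⟩
      exact x.isLt
    · intro hy
      have : (⟨y, hy⟩ : Fin n) ∈ Finset.univ.biUnion A := hcover ▸ Finset.mem_univ _
      obtain ⟨j, -, hj⟩ := Finset.mem_biUnion.1 this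
      exact ⟨j, _, hj, rfl⟩
  have hcard : ∀ j, ((A j).map Fin.valEmbedding).card = m := fun j => by
    rw [Finset.card_map, (hA j).1]
  refine ⟨fun j => (A j).map Fin.valEmbedding,
    injective_of_mul_lt_card_biUnion hcard (by rw [hunion, Finset.card_range]; exact hpm),
    fun j => ⟨?_, ?_, ?_⟩, fun j k => (hA j).2.trans (hA k).2.symm, hunion⟩
  · rw [← hunion]
    exact Finset.subset_biUnion_of_mem (fun j => (A j).map Fin.valEmbedding) (Finset.mem_univ j)
  all_goals
    have hp0 : (0 : ℝ) < p := by exact_mod_cast (by omega : 0 < p)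
    rw [hcard]
  · have h1 : (p : ℝ) ≤ δ * n := by
      rw [div_le_iff₀ hδ] at hM
      have : (M : ℝ) ≤ n := by exact_mod_cast le_trans (Nat.le_add_right _ _) hn
      nlinarith
    have h2 : (n : ℝ) ≤ p * (m + 1) := by exact_mod_cast hpm'
    rw [div_le_iff₀ hp0]
    linarith
  · have h1 : (p : ℝ) * m < n := by exact_mod_cast hpm
    have h2 : 0 ≤ δ * n := by positivity
    rw [le_div_iff₀ hp0]
    linarith
end

section
/- Let c be a 2-coloring of the 2-element subsets of ℕ with colors {0,1}, let i ∈ {0,1}, and assume that the relation defined by m ≺ n iff (m < n and c({m,n}) = i) is transitive. Then for every M ⊆ ℕ: (1) M is the union of finitely many (1−i)-homogeneous sets if and only if there exists L ∈ ℕ such that every finite i-homogeneous subset of M has cardinality at most L; and (2) M is the union of finitely many i-homogeneous sets if and only if there exists L ∈ ℕ such that every finite (1−i)-homogeneous subset of M has cardinality at most L. -/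
/-- `A` is `j`-homogeneous for the coloring `c` of 2-element subsets of `ℕ`:
every pair from `A` has color `j` (here `1 = true`, `0 = false`). -/
def Homog2 (c : Finset ℕ → Bool) (j : Bool) (A : Set ℕ) : Prop :=
  ∀ m ∈ A, ∀ n ∈ A, m < n → c {m, n} = j

/-- Finite Dilworth theorem, for a transitive relation contained in a linear order. -/
theorem exists_chain_coloring_of_antichain_card_le {α : Type*} [LinearOrder α]
    {r : α → α → Prop} (hlt : ∀ x y, r x y → x < y)
    (htrans : ∀ x y z, r x y → r y z → r x z) (S : Finset α) (k : ℕ)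
    (hS : ∀ A ⊆ S, (∀ x ∈ A, ∀ y ∈ A, ¬ r x y) → A.card ≤ k) :
    ∃ f : α → ℕ, (∀ x ∈ S, f x < k) ∧
      ∀ x ∈ S, ∀ y ∈ S, x < y → f x = f y → r x y := by
  classical
  induction hn : S.card using Nat.strong_induction_on generalizing S k with
  | _ n ih =>
  subst hn
  rcases S.eq_empty_or_nonempty with rfl | hne
  · exact ⟨fun _ => 0, by simp, by simp⟩
  set a := S.max' hne with ha
  have haS : a ∈ S := S.max'_mem hne
  have hmax : ∀ x ∈ S, x ≤ a := fun x hx => S.le_max' x hx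
  have hirr : ∀ x, ¬ r x x := fun x hx => lt_irrefl x (hlt x x hx)
  obtain ⟨k, rfl⟩ : ∃ l, k = l + 1 := by
    have := hS {a} (by simpa using haS) (by simpa using hirr a)
    exact ⟨k - 1, by simp at this; omega⟩
  -- It suffices to remove a chain through `a` that meets every antichain of size `k + 1`.
  suffices h : ∃ K ⊆ S, a ∈ K ∧ (∀ x ∈ K, ∀ y ∈ K, x < y → r x y) ∧
      ∀ A ⊆ S \ K, (∀ x ∈ A, ∀ y ∈ A, ¬ r x y) → A.card ≤ k by
    obtain ⟨K, hKS, haK, hK, hA⟩ := h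
    obtain ⟨f, hfk, hf⟩ := ih (S \ K).card
      (Finset.card_lt_card (Finset.sdiff_ssubset hKS ⟨a, haK⟩)) (S \ K) k hA rfl
    refine ⟨fun x => if x ∈ K then k else f x, ?_, ?_⟩
    · intro x hx
      by_cases hxK : x ∈ K
      · simp [hxK]
      · have := hfk x (by simp [hx, hxK])
        simp only [hxK, if_false]
        omega
    · intro x hx y hy hxy hfxy
      by_cases hxK : x ∈ K <;> by_cases hyK : y ∈ K <;>
        simp only [hxK, hyK, if_true, if_false] at hfxy
      · exact hK x hxK y hyK hxy
      · have := hfk y (by simp [hy, hyK])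
        omega
      · have := hfk x (by simp [hx, hxK])
        omega
      · exact hf x (by simp [hx, hxK]) y (by simp [hy, hyK]) hxy hfxy
  by_cases hk : ∀ A ⊆ S.erase a, (∀ x ∈ A, ∀ y ∈ A, ¬ r x y) → A.card ≤ k
  · refine ⟨{a}, by simpa using haS, by simp, ?_, ?_⟩
    · intro x hx y hy hxy
      rw [Finset.mem_singleton] at hx hy
      subst hx
      exact absurd hxy (by simp [hy])
    · simpa [Finset.sdiff_singleton_eq_erase] using hk
  push Not at hk
  obtain ⟨B, hBS, hB, hBk⟩ := hk
  obtain ⟨f, hfk, hf⟩ := ih (S.erase a).card (Finset.card_erase_lt_of_mem haS) (S.erase a) (k + 1)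
    (fun A hA => hS A (hA.trans (Finset.erase_subset _ _))) rfl
  have hmeet : ∀ A ⊆ S.erase a, (∀ x ∈ A, ∀ y ∈ A, ¬ r x y) → k < A.card →
      ∀ j < k + 1, ∃ x ∈ A, f x = j := by
    intro A hA hanti hcard j hj
    have hinj : Set.InjOn f A := by
      intro x hx y hy hxy
      rcases lt_trichotomy x y with h | h | h
      · exact absurd (hf x (hA hx) y (hA hy) h hxy) (hanti x hx y hy)
      · exact h
      · exact absurd (hf y (hA hy) x (hA hx) h hxy.symm) (hanti y hy x hx)
    have himg : A.image f = Finset.range (k + 1) := by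
      apply Finset.eq_of_subset_of_card_le
      · intro z hz
        obtain ⟨x, hx, rfl⟩ := Finset.mem_image.1 hz
        exact Finset.mem_range.2 (hfk x (hA hx))
      · rw [Finset.card_image_of_injOn hinj, Finset.card_range]
        omega
    have : j ∈ A.image f := by rw [himg]; exact Finset.mem_range.2 hj
    simpa using this
  -- In each color class, take the largest element lying in an antichain of size `k + 1`.
  have htop : ∀ j : Fin (k + 1), ∃ x, f x = j ∧
      (∃ A ⊆ S.erase a, (∀ x ∈ A, ∀ y ∈ A, ¬ r x y) ∧ k < A.card ∧ x ∈ A) ∧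
      ∀ A ⊆ S.erase a, (∀ x ∈ A, ∀ y ∈ A, ¬ r x y) → k < A.card →
        ∀ z ∈ A, f z = j → z ≤ x := by
    intro j
    let T := (S.erase a).filter fun x => f x = j ∧
      ∃ A ⊆ S.erase a, (∀ x ∈ A, ∀ y ∈ A, ¬ r x y) ∧ k < A.card ∧ x ∈ A
    have hT : T.Nonempty := by
      obtain ⟨x, hx, hxj⟩ := hmeet B hBS hB hBk j j.2
      exact ⟨x, Finset.mem_filter.2 ⟨hBS hx, hxj, B, hBS, hB, hBk, hx⟩⟩
    have hm := Finset.mem_filter.1 (T.max'_mem hT)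
    refine ⟨T.max' hT, hm.2.1, hm.2.2, ?_⟩
    intro A hA hanti hcard z hz hzj
    exact T.le_max' z (Finset.mem_filter.2 ⟨hA hz, hzj, A, hA, hanti, hcard, hz⟩)
  choose t htj htA htmax using htop
  have htS : ∀ j, t j ∈ S.erase a := fun j => by
    obtain ⟨A, hA, -, -, hx⟩ := htA j
    exact hA hx
  have htanti : ∀ p q, ¬ r (t p) (t q) := by
    intro p q hpq
    obtain ⟨A, hA, hanti, hcard, hq⟩ := htA q
    obtain ⟨y, hy, hyp⟩ := hmeet A hA hanti hcard p p.2
    rcases (htmax p A hA hanti hcard y hy hyp).lt_or_eq with h | h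
    · exact hanti y hy _ hq
        (htrans _ _ _ (hf y (hA hy) _ (htS p) h (hyp.trans (htj p).symm)) hpq)
    · exact hanti y hy _ hq (h ▸ hpq)
  have htinj : Function.Injective t := fun p q h => Fin.ext (by rw [← htj p, ← htj q, h])
  obtain ⟨j, hj⟩ : ∃ j, r (t j) a := by
    by_contra! hcon
    have haT : a ∉ Finset.univ.image t := by
      intro h
      obtain ⟨p, -, hp⟩ := Finset.mem_image.1 h
      exact (Finset.mem_erase.1 (htS p)).1 hp
    have := hS (insert a (Finset.univ.image t)) ?_ ?_
    · rw [Finset.card_insert_of_notMem haT, Finset.card_image_of_injective _ htinj] at this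
      simp at this
    · intro x hx
      rcases Finset.mem_insert.1 hx with rfl | hx
      · exact haS
      · obtain ⟨p, -, rfl⟩ := Finset.mem_image.1 hx
        exact Finset.mem_of_mem_erase (htS p)
    · intro x hx y hy
      rcases Finset.mem_insert.1 hy with rfl | hy
      · rcases Finset.mem_insert.1 hx with rfl | hx
        · exact hirr _
        · obtain ⟨p, -, rfl⟩ := Finset.mem_image.1 hx
          exact hcon p
      · obtain ⟨q, -, rfl⟩ := Finset.mem_image.1 hy
        rcases Finset.mem_insert.1 hx with rfl | hx
        · exact fun h => (hlt _ _ h).not_ge (hmax _ (Finset.mem_of_mem_erase (htS q)))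
        · obtain ⟨p, -, rfl⟩ := Finset.mem_image.1 hx
          exact htanti p q
  have hbelow : ∀ x ∈ S.erase a, f x = j → x ≤ t j → r x a := by
    intro x hx hxj hxt
    rcases hxt.lt_or_eq with h | h
    · exact htrans _ _ _ (hf x hx _ (htS j) h (hxj.trans (htj j).symm)) hj
    · exact h ▸ hj
  refine ⟨insert a ((S.erase a).filter fun x => f x = j ∧ x ≤ t j), ?_,
    Finset.mem_insert_self _ _, ?_, ?_⟩
  · exact Finset.insert_subset haS
      ((Finset.filter_subset _ _).trans (Finset.erase_subset _ _))
  · intro x hx y hy hxy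
    simp only [Finset.mem_insert, Finset.mem_filter] at hx hy
    rcases hy with rfl | ⟨hyS, hyj, hyt⟩
    · rcases hx with rfl | ⟨hxS, hxj, hxt⟩
      · exact absurd hxy (lt_irrefl _)
      · exact hbelow x hxS hxj hxt
    · rcases hx with rfl | ⟨hxS, hxj, hxt⟩
      · exact absurd hxy (hmax y (Finset.mem_of_mem_erase hyS)).not_gt
      · exact hf x hxS y hyS hxy (hxj.trans hyj.symm)
  · intro A hA hanti
    by_contra! hcard
    have hAS : A ⊆ S.erase a := by
      intro x hx
      have h := Finset.mem_sdiff.1 (hA hx)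
      exact Finset.mem_erase.2 ⟨fun h' => h.2 (h' ▸ Finset.mem_insert_self _ _), h.1⟩
    obtain ⟨z, hz, hzj⟩ := hmeet A hAS hanti hcard j j.2
    exact (Finset.mem_sdiff.1 (hA hz)).2 (Finset.mem_insert_of_mem
      (Finset.mem_filter.2 ⟨hAS hz, hzj, htmax j A hAS hanti hcard z hz hzj⟩))

/-- Dilworth's theorem for subsets of `ℕ`, by compactness from the finite case. -/
theorem exists_chain_coloring_nat {r : ℕ → ℕ → Prop} (hlt : ∀ x y, r x y → x < y)
    (htrans : ∀ x y z, r x y → r y z → r x z) (M : Set ℕ) (k : ℕ)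
    (hM : ∀ A : Finset ℕ, (A : Set ℕ) ⊆ M → (∀ x ∈ A, ∀ y ∈ A, ¬ r x y) → A.card ≤ k) :
    ∃ F : ℕ → Fin (k + 1), ∀ x ∈ M, ∀ y ∈ M, x < y → F x = F y → r x y := by
  classical
  have hfin : ∀ n : ℕ, ∃ f : ℕ → Fin (k + 1),
      ∀ x ∈ M, ∀ y ∈ M, x < n → y < n → x < y → f x = f y → r x y := by
    intro n
    obtain ⟨f, hfk, hf⟩ := exists_chain_coloring_of_antichain_card_le hlt htrans
      ((Finset.range n).filter (· ∈ M)) k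
      (fun A hA => hM A fun x hx => (Finset.mem_filter.1 (hA hx)).2)
    refine ⟨fun x => Fin.ofNat (k + 1) (f x), fun x hx y hy hxn hyn hxy h => ?_⟩
    have hx' : x ∈ (Finset.range n).filter (· ∈ M) := by simp [hx, hxn]
    have hy' : y ∈ (Finset.range n).filter (· ∈ M) := by simp [hy, hyn]
    refine hf x hx' y hy' hxy ?_
    have h' := congrArg Fin.val h
    have h1 := hfk x hx'
    have h2 := hfk y hy'
    simpa [Fin.ofNat, Nat.mod_eq_of_lt (show f x < k + 1 by omega),
      Nat.mod_eq_of_lt (show f y < k + 1 by omega)] using h'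
  choose f hf using hfin
  have hlim : ∀ x, ∃ j, ∀ᶠ n in (Filter.hyperfilter ℕ : Filter ℕ), f n x = j := by
    intro x
    obtain ⟨j, hj⟩ := Ultrafilter.eq_pure_of_finite ((Filter.hyperfilter ℕ).map fun n => f n x)
    refine ⟨j, ?_⟩
    have : ({j} : Set (Fin (k + 1))) ∈ (Filter.hyperfilter ℕ).map fun n => f n x := by
      rw [hj]
      exact Ultrafilter.mem_pure.2 rfl
    exact this
  choose F hF using hlim
  refine ⟨F, fun x hx y hy hxy h => ?_⟩
  have hgt : ∀ᶠ n in (Filter.hyperfilter ℕ : Filter ℕ), y < n := by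
    apply Filter.hyperfilter_le_cofinite
    rw [Nat.cofinite_eq_atTop]
    exact Filter.eventually_gt_atTop y
  obtain ⟨n, hnx, hny, hn⟩ := ((hF x).and ((hF y).and hgt)).exists
  exact hf n x hx y hy (hxy.trans hn) hn hxy (by rw [hnx, hny, h])

/-- Mirsky's theorem: bounded chains give a finite partition into antichains. -/
theorem exists_antichain_coloring {α : Type*} [LinearOrder α] {r : α → α → Prop}
    (hlt : ∀ x y, r x y → x < y) (htrans : ∀ x y z, r x y → r y z → r x z) (M : Set α) (k : ℕ)
    (hM : ∀ A : Finset α, (A : Set α) ⊆ M → (∀ x ∈ A, ∀ y ∈ A, x < y → r x y) → A.card ≤ k) :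
    ∃ F : α → Fin (k + 1), ∀ x ∈ M, ∀ y ∈ M, F x = F y → ¬ r x y := by
  classical
  let P : α → ℕ → Prop := fun x n => ∃ A : Finset α, (A : Set α) ⊆ M ∧
    (∀ u ∈ A, ∀ v ∈ A, u < v → r u v) ∧ x ∈ A ∧ (∀ u ∈ A, u ≤ x) ∧ A.card = n
  have hPk : ∀ x n, P x n → n ≤ k := by
    rintro x n ⟨A, hA, hc, -, -, rfl⟩
    exact hM A hA hc
  have hP1 : ∀ x ∈ M, P x 1 := fun x hx =>
    ⟨{x}, by simpa using hx, by simp, by simp, by simp, by simp⟩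
  refine ⟨fun x => ⟨Nat.findGreatest (P x) k, Nat.lt_succ_of_le (Nat.findGreatest_le k)⟩, ?_⟩
  intro x hx y hy hxy hr
  have heq : Nat.findGreatest (P x) k = Nat.findGreatest (P y) k := congrArg Fin.val hxy
  have hPx : P x (Nat.findGreatest (P x) k) :=
    Nat.findGreatest_spec (hPk x 1 (hP1 x hx)) (hP1 x hx)
  obtain ⟨A, hA, hc, hxA, hle, hcard⟩ := hPx
  have hltA : ∀ u ∈ A, u < y := fun u hu => (hle u hu).trans_lt (hlt _ _ hr)
  have hPy : P y (Nat.findGreatest (P x) k + 1) := by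
    refine ⟨insert y A, ?_, ?_, by simp, ?_, ?_⟩
    · rw [Finset.coe_insert]
      exact Set.insert_subset hy hA
    · intro u hu v hv huv
      rcases Finset.mem_insert.1 hv with rfl | hvA
      · rcases Finset.mem_insert.1 hu with rfl | hu
        · exact absurd huv (lt_irrefl _)
        · rcases (hle u hu).lt_or_eq with h | h
          · exact htrans _ _ _ (hc u hu x hxA h) hr
          · exact h ▸ hr
      · rcases Finset.mem_insert.1 hu with rfl | hu
        · exact absurd huv (hltA v hvA).not_gt
        · exact hc u hu v hvA huv
    · intro u hu
      rcases Finset.mem_insert.1 hu with rfl | hu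
      · exact le_rfl
      · exact (hltA u hu).le
    · rw [Finset.card_insert_of_notMem fun h => lt_irrefl y (hltA y h), hcard]
  have := Nat.le_findGreatest (hPk y _ hPy) hPy
  omega

theorem Homog2.card_le_of_iUnion {c : Finset ℕ → Bool} {i j : Bool} (hij : i ≠ j) {m : ℕ}
    {X : Fin m → Set ℕ} (hX : ∀ p, Homog2 c i (X p)) {H : Finset ℕ}
    (hsub : (H : Set ℕ) ⊆ ⋃ p, X p) (hH : Homog2 c j H) : H.card ≤ m := by
  classical
  have hex : ∀ x : H, ∃ p, (x : ℕ) ∈ X p := fun x => Set.mem_iUnion.1 (hsub x.2)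
  choose g hg using hex
  have key : ∀ x y : H, g x = g y → ¬ (x : ℕ) < y := fun x y h hlt =>
    hij ((hX (g x) x (hg x) y (h ▸ hg y) hlt).symm.trans (hH x x.2 y y.2 hlt))
  have hinj : Function.Injective g := fun x y h =>
    Subtype.ext (le_antisymm (not_lt.1 (key y x h.symm)) (not_lt.1 (key x y h)))
  simpa using Fintype.card_le_of_injective g hinj

theorem exists_iUnion_homog2_of_coloring {c : Finset ℕ → Bool} {i : Bool} {M : Set ℕ} {m : ℕ}
    (F : ℕ → Fin m) (hF : ∀ x ∈ M, ∀ y ∈ M, x < y → F x = F y → c {x, y} = i) :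
    ∃ (m : ℕ) (X : Fin m → Set ℕ), M = ⋃ j, X j ∧ ∀ j, Homog2 c i (X j) := by
  refine ⟨m, fun j => {x ∈ M | F x = j}, ?_, ?_⟩
  · ext x
    simp
  · rintro j x ⟨hx, hxj⟩ y ⟨hy, hyj⟩ hxy
    exact hF x hx y hy hxy (hxj.trans hyj.symm)

theorem stmt16 (c : Finset ℕ → Bool) (i : Bool)
    (htrans : Transitive fun m n : ℕ => m < n ∧ c {m, n} = i) :
    ∀ M : Set ℕ,
      ((∃ (m : ℕ) (X : Fin m → Set ℕ), M = ⋃ j, X j ∧ ∀ j, Homog2 c (!i) (X j)) ↔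
        ∃ L : ℕ, ∀ H : Finset ℕ, (↑H : Set ℕ) ⊆ M → Homog2 c i ↑H → H.card ≤ L) ∧
      ((∃ (m : ℕ) (X : Fin m → Set ℕ), M = ⋃ j, X j ∧ ∀ j, Homog2 c i (X j)) ↔
        ∃ L : ℕ, ∀ H : Finset ℕ, (↑H : Set ℕ) ⊆ M → Homog2 c (!i) ↑H → H.card ≤ L) := by
  intro M
  have hlt : ∀ x y, (x < y ∧ c {x, y} = i) → x < y := fun _ _ h => h.1
  have htr : ∀ x y z, (x < y ∧ c {x, y} = i) → (y < z ∧ c {y, z} = i) →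
      (x < z ∧ c {x, z} = i) := fun x y z h₁ h₂ => htrans h₁ h₂
  refine ⟨⟨?_, ?_⟩, ⟨?_, ?_⟩⟩
  · rintro ⟨m, X, rfl, hX⟩
    exact ⟨m, fun H hH hc => Homog2.card_le_of_iUnion (by simp) hX hH hc⟩
  · rintro ⟨L, hL⟩
    obtain ⟨F, hF⟩ := exists_antichain_coloring hlt htr M L
      fun A hA hc => hL A hA fun x hx y hy hxy => (hc x hx y hy hxy).2
    exact exists_iUnion_homog2_of_coloring F fun x hx y hy hxy h =>
      Bool.eq_not.2 fun hc => hF x hx y hy h ⟨hxy, hc⟩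
  · rintro ⟨m, X, rfl, hX⟩
    exact ⟨m, fun H hH hc => Homog2.card_le_of_iUnion (by simp) hX hH hc⟩
  · rintro ⟨L, hL⟩
    obtain ⟨F, hF⟩ := exists_chain_coloring_nat hlt htr M L
      fun A hA hc => hL A hA fun x hx y hy hxy =>
        Bool.eq_not.2 fun h => hc x hx y hy ⟨hxy, h⟩
    exact exists_iUnion_homog2_of_coloring F fun x hx y hy hxy h => (hF x hx y hy hxy h).2
end

section
/- Let θ : ℕ → ℚ be a bijection, let l ≥ 1, and let c be a coloring of the 2-element subsets of ℕ with l colors. Define θ̂ on 2-element subsets by θ̂({m,n}) = 1, for m < n, if and only if θ(m) < θ(n), and θ̂({m,n}) = 0 otherwise. Then there exists M ⊆ ℕ such that the set θ(M) ⊆ ℚ, with the order inherited from ℚ, is order-isomorphic to ℚ, and every θ̂-homogeneous subset of M is c-homogeneous. -/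
/-- A set of rationals is `ContainsRat` if it contains a subset of order type `ℚ`, that is, if it is
not scattered. -/
def ContainsRat (S : Set ℚ) : Prop :=
  ∃ f : ℚ → ℚ, StrictMono f ∧ ∀ q, f q ∈ S

namespace ContainsRat

theorem mono {S T : Set ℚ} (h : S ⊆ T) (hS : ContainsRat S) : ContainsRat T := by
  obtain ⟨f, hf, hfS⟩ := hS
  exact ⟨f, hf, fun q => h (hfS q)⟩

theorem univ : ContainsRat Set.univ := ⟨id, strictMono_id, fun _ => trivial⟩

theorem infinite {S : Set ℚ} (hS : ContainsRat S) : S.Infinite := by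
  obtain ⟨f, hf, hfS⟩ := hS
  exact (Set.infinite_range_of_injective hf.injective).mono (Set.range_subset_iff.2 hfS)

theorem of_dense (S : Set ℚ) (h : ∀ a b : ℚ, a < b → ∃ s ∈ S, a < s ∧ s < b) :
    ContainsRat S := by
  have : DenselyOrdered S := ⟨fun a b hab => by
    obtain ⟨s, hs, h1, h2⟩ := h a b hab
    exact ⟨⟨s, hs⟩, h1, h2⟩⟩
  have : Nontrivial S := by
    obtain ⟨s, hs, h1, h2⟩ := h 0 1 (by norm_num)
    obtain ⟨t, ht, h3, h4⟩ := h 1 2 (by norm_num)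
    exact ⟨⟨s, hs⟩, ⟨t, ht⟩, fun e => (h2.trans h3).ne (congrArg Subtype.val e)⟩
  obtain ⟨f⟩ := Order.embedding_from_countable_to_dense ℚ S
  exact ⟨fun q => f q, fun a b hab => f.strictMono hab, fun q => (f q).2⟩

theorem Ioo {a b : ℚ} (hab : a < b) : ContainsRat (Set.Ioo a b) := by
  have : Nontrivial (Set.Ioo a b) := by
    obtain ⟨s, h1, h2⟩ := exists_between hab
    obtain ⟨t, h3, h4⟩ := exists_between h2
    exact ⟨⟨s, h1, h2⟩, ⟨t, h1.trans h3, h4⟩, fun e => h3.ne (congrArg Subtype.val e)⟩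
  obtain ⟨f⟩ := Order.embedding_from_countable_to_dense ℚ (Set.Ioo a b)
  exact ⟨fun q => f q, fun a b hab => f.strictMono hab, fun q => (f q).2⟩

theorem image {S : Set ℚ} (hS : ContainsRat S) {f : ℚ → ℚ} (hf : StrictMono f) :
    ContainsRat (f '' S) := by
  obtain ⟨g, hg, hgS⟩ := hS
  exact ⟨f ∘ g, hf.comp hg, fun q => ⟨g q, hgS q, rfl⟩⟩

theorem of_union {S T : Set ℚ} (h : ContainsRat (S ∪ T)) : ContainsRat S ∨ ContainsRat T := by
  obtain ⟨f, hf, hfS⟩ := h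
  by_cases hd : ∀ a b : ℚ, a < b → ∃ s ∈ f ⁻¹' S, a < s ∧ s < b
  · exact .inl (((of_dense _ hd).image hf).mono (Set.image_preimage_subset _ _))
  · push Not at hd
    obtain ⟨a, b, hab, hs⟩ := hd
    refine .inr (((Ioo hab).image hf).mono ?_)
    rintro _ ⟨q, hq, rfl⟩
    exact (hfS q).resolve_left fun hqS => (hs q hqS hq.1).not_gt hq.2

theorem of_biUnion {ι : Type*} {I : Set ι} (hI : I.Finite) {S : ι → Set ℚ}
    (h : ContainsRat (⋃ i ∈ I, S i)) : ∃ i ∈ I, ContainsRat (S i) := by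
  induction I, hI using Set.Finite.induction_on with
  | empty => simpa using h.infinite
  | insert _ _ ih =>
    rw [Set.biUnion_insert] at h
    rcases h.of_union with h | h
    · exact ⟨_, Set.mem_insert _ _, h⟩
    · obtain ⟨i, hi, h⟩ := ih h
      exact ⟨i, Set.mem_insert_of_mem _ hi, h⟩

theorem diff {S T : Set ℚ} (hS : ContainsRat S) (hT : ¬ ContainsRat T) : ContainsRat (S \ T) :=
  (of_union (S := S \ T) (T := T)
    (hS.mono (by rw [Set.sdiff_union_self]; exact Set.subset_union_left))).resolve_right hT

theorem exists_lt_split {S : Set ℚ} (hS : ContainsRat S) :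
    ∃ B ⊆ S, ∃ C ⊆ S, ContainsRat B ∧ ContainsRat C ∧ ∀ x ∈ B, ∀ y ∈ C, x < y := by
  obtain ⟨f, hf, hfS⟩ := hS
  refine ⟨f '' Set.Ioo 0 1, ?_, f '' Set.Ioo 1 2, ?_, (Ioo (by norm_num)).image hf,
    (Ioo (by norm_num)).image hf, ?_⟩
  · rintro _ ⟨q, -, rfl⟩
    exact hfS q
  · rintro _ ⟨q, -, rfl⟩
    exact hfS q
  · rintro _ ⟨p, hp, rfl⟩ _ ⟨q, hq, rfl⟩
    exact hf (hp.2.trans hq.1)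

end ContainsRat

section

variable {κ : Type*}

/-- The color `k` cannot be avoided between `B` and `C`: on all non-scattered subsets some point of
the first has color `k` with non-scattered many points of the second. -/
def Unavoidable (d : ℚ → ℚ → κ) (k : κ) (B C : Set ℚ) : Prop :=
  ∀ B' ⊆ B, ∀ C' ⊆ C, ContainsRat B' → ContainsRat C' →
    ∃ x ∈ B', ContainsRat {y | y ∈ C' ∧ d x y = k}

theorem Unavoidable.mono {d : ℚ → ℚ → κ} {k : κ} {B C B' C' : Set ℚ}
    (h : Unavoidable d k B C) (hB : B' ⊆ B) (hC : C' ⊆ C) : Unavoidable d k B' C' :=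
  fun _ h1 _ h2 => h _ (h1.trans hB) _ (h2.trans hC)

theorem Unavoidable.not_containsRat {d : ℚ → ℚ → κ} {k : κ} {B C : Set ℚ}
    (h : Unavoidable d k B C) (hC : ContainsRat C) :
    ¬ ContainsRat {x | x ∈ B ∧ ¬ ContainsRat {y | y ∈ C ∧ d x y = k}} := by
  intro hB
  obtain ⟨x, hx, hx'⟩ := h _ (fun x hx => hx.1) C subset_rfl hB hC
  exact hx.2 hx'

theorem exists_unavoidable [Finite κ] (d : ℚ → ℚ → κ) {B C : Set ℚ} (hB : ContainsRat B)
    (hC : ContainsRat C) :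
    ∃ B' ⊆ B, ∃ C' ⊆ C, ContainsRat B' ∧ ContainsRat C' ∧ ∃ k, Unavoidable d k B' C' := by
  by_contra! hcon
  have key : ∀ K : Set κ, K.Finite → ∃ B' ⊆ B, ∃ C' ⊆ C, ContainsRat B' ∧ ContainsRat C' ∧
      ∀ k ∈ K, ∀ x ∈ B', ¬ ContainsRat {y | y ∈ C' ∧ d x y = k} := by
    intro K hK
    induction K, hK using Set.Finite.induction_on with
    | empty => exact ⟨B, subset_rfl, C, subset_rfl, hB, hC, by simp⟩
    | @insert k K _ _ ih =>
      obtain ⟨B', hB', C', hC', hbB, hbC, h⟩ := ih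
      have := hcon B' hB' C' hC' hbB hbC k
      simp only [Unavoidable, not_forall, not_exists, not_and] at this
      obtain ⟨B₂, hB₂, C₂, hC₂, hbB₂, hbC₂, h₂⟩ := this
      refine ⟨B₂, hB₂.trans hB', C₂, hC₂.trans hC', hbB₂, hbC₂, ?_⟩
      rintro k' (rfl | hk') x hx
      · exact h₂ x hx
      · exact fun hb => h k' hk' x (hB₂ hx) (hb.mono fun y hy => ⟨hC₂ hy.1, hy.2⟩)
  obtain ⟨B', -, C', -, hbB, hbC, h⟩ := key Set.univ Set.finite_univ
  obtain ⟨x, hx⟩ := hbB.infinite.nonempty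
  obtain ⟨k, hk, hb⟩ := ContainsRat.of_biUnion (Set.finite_univ (α := κ))
    (S := fun k => {y | y ∈ C' ∧ d x y = k}) (hbC.mono fun y hy => by simpa using hy)
  exact h k hk x hx hb

/-- `B` lies below `C`, and `k₁` is unavoidable from `B` to `C`, `k₀` from `C` to `B`. -/
def Good (d : ℚ → ℚ → κ) (k₀ k₁ : κ) (B C : Set ℚ) : Prop :=
  (∀ x ∈ B, ∀ y ∈ C, x < y) ∧ Unavoidable d k₁ B C ∧ Unavoidable d k₀ C B

theorem Good.mono {d : ℚ → ℚ → κ} {k₀ k₁ : κ} {B C B' C' : Set ℚ}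
    (h : Good d k₀ k₁ B C) (hB : B' ⊆ B) (hC : C' ⊆ C) : Good d k₀ k₁ B' C' :=
  ⟨fun x hx y hy => h.1 x (hB hx) y (hC hy), h.2.1.mono hB hC, h.2.2.mono hC hB⟩

/-- Every non-scattered subset of `A` contains a good pair for `k₀` and `k₁`. -/
def HereditarilyGood (d : ℚ → ℚ → κ) (k₀ k₁ : κ) (A : Set ℚ) : Prop :=
  ∀ A' ⊆ A, ContainsRat A' →
    ∃ B ⊆ A', ∃ C ⊆ A', ContainsRat B ∧ ContainsRat C ∧ Good d k₀ k₁ B C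

theorem exists_good [Finite κ] (d : ℚ → ℚ → κ) {A : Set ℚ} (hA : ContainsRat A) :
    ∃ k₀ k₁, ∃ B ⊆ A, ∃ C ⊆ A, ContainsRat B ∧ ContainsRat C ∧ Good d k₀ k₁ B C := by
  obtain ⟨B, hB, C, hC, hbB, hbC, hlt⟩ := hA.exists_lt_split
  obtain ⟨B₁, hB₁, C₁, hC₁, hbB₁, hbC₁, k₁, h₁⟩ := exists_unavoidable d hbB hbC
  obtain ⟨C₂, hC₂, B₂, hB₂, hbC₂, hbB₂, k₀, h₀⟩ := exists_unavoidable d hbC₁ hbB₁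
  exact ⟨k₀, k₁, B₂, hB₂.trans (hB₁.trans hB), C₂, hC₂.trans (hC₁.trans hC), hbB₂, hbC₂,
    fun x hx y hy => hlt x (hB₁ (hB₂ hx)) y (hC₁ (hC₂ hy)), h₁.mono hB₂ hC₂, h₀⟩

theorem exists_hereditarilyGood [Finite κ] (d : ℚ → ℚ → κ) :
    ∃ k₀ k₁ A, ContainsRat A ∧ HereditarilyGood d k₀ k₁ A := by
  by_contra! hcon
  have key : ∀ K : Set (κ × κ), K.Finite → ∃ A, ContainsRat A ∧ ∀ k ∈ K,
      ¬ ∃ B ⊆ A, ∃ C ⊆ A, ContainsRat B ∧ ContainsRat C ∧ Good d k.1 k.2 B C := by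
    intro K hK
    induction K, hK using Set.Finite.induction_on with
    | empty => exact ⟨_, ContainsRat.univ, by simp⟩
    | @insert k K _ _ ih =>
      obtain ⟨A, hA, h⟩ := ih
      have := hcon k.1 k.2 A hA
      rw [HereditarilyGood] at this
      push Not at this
      obtain ⟨A', hA', hbA', h'⟩ := this
      refine ⟨A', hbA', ?_⟩
      rintro k' (rfl | hk') ⟨B, hB, C, hC, hbB, hbC, hg⟩
      · exact h' B hB C hC hbB hbC hg
      · exact h k' hk' ⟨B, hB.trans hA', C, hC.trans hA', hbB, hbC, hg⟩
  obtain ⟨A, hA, h⟩ := key Set.univ Set.finite_univ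
  obtain ⟨k₀, k₁, hg⟩ := exists_good d hA
  exact h (k₀, k₁) trivial hg

theorem HereditarilyGood.exists_triple {d : ℚ → ℚ → κ} {k₀ k₁ : κ} {A S : Set ℚ}
    (hA : HereditarilyGood d k₀ k₁ A) (hS : S ⊆ A) (hbS : ContainsRat S) :
    ∃ B₀ ⊆ S, ∃ B₁ ⊆ S, ∃ B₂ ⊆ S, ContainsRat B₀ ∧ ContainsRat B₁ ∧ ContainsRat B₂ ∧
      Good d k₀ k₁ B₀ B₁ ∧ Good d k₀ k₁ B₁ B₂ ∧ Good d k₀ k₁ B₀ B₂ := by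
  obtain ⟨B, hB, C, hC, hbB, hbC, hg⟩ := hA S hS hbS
  obtain ⟨D, hD, E, hE, hbD, hbE, hg'⟩ := hA C (hC.trans hS) hbC
  exact ⟨B, hB, D, hD.trans hC, E, hE.trans hC, hbB, hbD, hbE, hg.mono subset_rfl hD, hg',
    hg.mono subset_rfl hE⟩

/-- A finite system of reservoirs: `G t` is a set in which the image of `t` can still be chosen. -/
structure IsReservoir (d : ℚ → ℚ → κ) (k₀ k₁ : κ) (A : Set ℚ) (G : ℚ → Set ℚ) : Prop where
  finite : (Set.range G).Finite
  containsRat : ∀ t, ContainsRat (G t)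
  subset : ∀ t, G t ⊆ A
  good : ∀ t t', t < t' → G t = G t' ∨ Good d k₀ k₁ (G t) (G t')

theorem IsReservoir.exists_step {d : ℚ → ℚ → κ} {k₀ k₁ : κ} {A : Set ℚ} {G : ℚ → Set ℚ}
    (hG : IsReservoir d k₀ k₁ A G) (hA : HereditarilyGood d k₀ k₁ A) {r : ℚ → ℕ}
    (hr : Function.Injective r) (t₀ : ℚ) :
    ∃ G' x, IsReservoir d k₀ k₁ A G' ∧ (∀ t, G' t ⊆ G t) ∧ x ∈ G t₀ ∧
      (∀ t, t < t₀ → ∀ y ∈ G' t, y < x ∧ r x < r y ∧ d x y = k₀) ∧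
      (∀ t, t₀ < t → ∀ y ∈ G' t, x < y ∧ r x < r y ∧ d x y = k₁) := by
  classical
  obtain ⟨B₀, hB₀, B₁, hB₁, B₂, hB₂, hb₀, hb₁, hb₂, h01, h12, h02⟩ :=
    hA.exists_triple (hG.subset t₀) (hG.containsRat t₀)
  let e : Set ℚ × Prop → Set ℚ := fun p => if p.1 = G t₀ then (if p.2 then B₂ else B₀) else p.1
  let col : Prop → κ := fun p => if p then k₁ else k₀
  let code : ℚ → Set ℚ × Prop := fun t => (G t, t₀ ≤ t)
  have hcode : (Set.range code).Finite := by
    refine (hG.finite.prod (Set.finite_univ (α := Prop))).subset ?_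
    rintro _ ⟨t, rfl⟩
    exact ⟨⟨t, rfl⟩, trivial⟩
  have hsub : ∀ t, e (code t) ⊆ G t := by
    intro t
    simp only [e, code]
    split_ifs with h1 h2
    · rwa [h1]
    · rwa [h1]
    · exact subset_rfl
  have hbig : ∀ t, ContainsRat (e (code t)) := by
    intro t
    simp only [e, code]
    split_ifs with h1 h2
    · exact hb₂
    · exact hb₀
    · exact hG.containsRat t
  have hup : ∀ t, t₀ ≤ t → Good d k₀ k₁ B₁ (e (code t)) := by
    intro t ht
    simp only [e, code, ht, if_true]
    split_ifs with h1
    · exact h12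
    · rcases ht.eq_or_lt with rfl | hlt
      · exact absurd rfl h1
      · exact ((hG.good _ _ hlt).resolve_left (Ne.symm h1)).mono hB₁ subset_rfl
  have hdown : ∀ t, t < t₀ → Good d k₀ k₁ (e (code t)) B₁ := by
    intro t ht
    simp only [e, code, ht.not_ge, if_false]
    split_ifs with h1
    · exact h01
    · exact ((hG.good _ _ ht).resolve_left h1).mono subset_rfl hB₁
  have hun : ∀ t, Unavoidable d (col (t₀ ≤ t)) B₁ (e (code t)) := by
    intro t
    by_cases ht : t₀ ≤ t
    · simpa only [col, ht, if_true] using (hup t ht).2.1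
    · simpa only [col, ht, if_false] using (hdown t (not_le.1 ht)).2.2
  obtain ⟨x, hx₁, hx⟩ : ∃ x ∈ B₁, ∀ t,
      ContainsRat {y | y ∈ e (code t) ∧ d x y = col (t₀ ≤ t)} := by
    have hbad : ¬ ContainsRat (⋃ p ∈ Set.range code,
        {x | x ∈ B₁ ∧ ¬ ContainsRat {y | y ∈ e p ∧ d x y = col p.2}}) := by
      intro h
      obtain ⟨_, ⟨t, rfl⟩, h⟩ := ContainsRat.of_biUnion hcode h
      exact (hun t).not_containsRat (hbig t) h
    obtain ⟨x, hx₁, hx⟩ := (hb₁.diff hbad).infinite.nonempty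
    refine ⟨x, hx₁, fun t => ?_⟩
    by_contra hcon
    exact hx (Set.mem_biUnion (Set.mem_range_self t) ⟨hx₁, hcon⟩)
  let F : Set ℚ × Prop → Set ℚ := fun p => {y | y ∈ e p ∧ d x y = col p.2} \ {y | r y ≤ r x}
  have hF : ∀ t, F (code t) ⊆ e (code t) := fun t y hy => hy.1.1
  refine ⟨fun t => F (code t), x, ⟨?_, ?_, ?_, ?_⟩, ?_, hB₁ hx₁, ?_, ?_⟩
  · refine (hcode.image F).subset ?_
    rintro _ ⟨t, rfl⟩
    exact ⟨_, ⟨t, rfl⟩, rfl⟩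
  · refine fun t => (hx t).diff fun h => h.infinite ?_
    exact (Set.finite_Iic (r x)).preimage hr.injOn
  · exact fun t => (hF t).trans ((hsub t).trans (hG.subset t))
  · intro t t' htt
    by_cases hgood : G t = G t'
    · by_cases hs : (t₀ ≤ t) = (t₀ ≤ t')
      · left
        simp only [code, hgood, hs]
      · right
        have h1 : t < t₀ := by
          by_contra h
          exact hs (by simp [not_lt.1 h, (not_lt.1 h).trans htt.le])
        have h2 : t₀ ≤ t' := by
          by_contra h
          exact hs (by simp [h, h1])
        have h3 : G t = G t₀ := by
          by_contra hne
          rcases h2.eq_or_lt with rfl | h2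
          · exact hne hgood
          have ha := (hG.good _ _ h1).resolve_left hne
          have hb := (hG.good _ _ h2).resolve_left (fun h => hne (hgood.trans h.symm))
          obtain ⟨u, hu⟩ := (hG.containsRat t).infinite.nonempty
          obtain ⟨v, hv⟩ := (hG.containsRat t₀).infinite.nonempty
          exact (ha.1 u hu v hv).not_gt (hb.1 v hv u (hgood ▸ hu))
        refine Good.mono (B := e (code t)) (C := e (code t')) ?_ (hF t) (hF t')
        simpa only [e, code, ← hgood, h3, h1.not_ge, h2, if_true, if_false] using h02
    · exact .inr (((hG.good t t' htt).resolve_left hgood).mono ((hF t).trans (hsub t))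
        ((hF t').trans (hsub t')))
  · exact fun t => (hF t).trans (hsub t)
  · intro t ht y hy
    refine ⟨(hdown t ht).1 y (hF t hy) x hx₁, not_le.1 hy.2, ?_⟩
    have := hy.1.2
    simpa only [col, code, ht.not_ge, if_false] using this
  · intro t ht y hy
    refine ⟨(hup t ht.le).1 x hx₁ y (hF t hy), not_le.1 hy.2, ?_⟩
    have := hy.1.2
    simpa only [col, code, ht.le, if_true] using this

theorem exists_canonical_sequence [Finite κ] (d : ℚ → ℚ → κ) {r : ℚ → ℕ}
    (hr : Function.Injective r) (θ : ℕ → ℚ) :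
    ∃ (k₀ k₁ : κ) (h : ℕ → ℚ), ∀ n m, n < m →
      (θ m < θ n → h m < h n ∧ r (h n) < r (h m) ∧ d (h n) (h m) = k₀) ∧
      (θ n < θ m → h n < h m ∧ r (h n) < r (h m) ∧ d (h n) (h m) = k₁) := by
  obtain ⟨k₀, k₁, A, hbA, hA⟩ := exists_hereditarilyGood d
  have step : ∀ (G : {G // IsReservoir d k₀ k₁ A G}) (t₀ : ℚ),
      ∃ (G' : {G // IsReservoir d k₀ k₁ A G}) (x : ℚ), (∀ t, G'.1 t ⊆ G.1 t) ∧ x ∈ G.1 t₀ ∧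
      (∀ t, t < t₀ → ∀ y ∈ G'.1 t, y < x ∧ r x < r y ∧ d x y = k₀) ∧
      (∀ t, t₀ < t → ∀ y ∈ G'.1 t, x < y ∧ r x < r y ∧ d x y = k₁) := by
    intro G t₀
    obtain ⟨G', x, hG', h⟩ := G.2.exists_step hA hr t₀
    exact ⟨⟨G', hG'⟩, x, h⟩
  choose next pt hsub hmem hlo hhi using step
  let G₀ : {G // IsReservoir d k₀ k₁ A G} :=
    ⟨fun _ => A, Set.finite_range_const, fun _ => hbA, fun _ => subset_rfl,
      fun _ _ _ => .inl rfl⟩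
  let seq : ℕ → {G // IsReservoir d k₀ k₁ A G} := fun n => Nat.rec G₀ (fun n G => next G (θ n)) n
  have hanti : ∀ t, Antitone fun n => (seq n).1 t :=
    fun t => antitone_nat_of_succ_le fun n => hsub (seq n) (θ n) t
  refine ⟨k₀, k₁, fun n => pt (seq n) (θ n), fun n m hnm => ?_⟩
  have hm : pt (seq m) (θ m) ∈ (seq (n + 1)).1 (θ m) := hanti (θ m) hnm (hmem (seq m) (θ m))
  exact ⟨fun h => hlo (seq n) (θ n) (θ m) h _ hm, fun h => hhi (seq n) (θ n) (θ m) h _ hm⟩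

end

theorem stmt17 (θ : ℕ → ℚ) (hθ : Function.Bijective θ) (l : ℕ) (hl : 1 ≤ l)
    (c : Finset ℕ → Fin l) :
    ∃ M : Set ℕ,
      Nonempty ((θ '' M) ≃o ℚ) ∧
      ∀ H : Set ℕ, H ⊆ M →
        ((∀ m ∈ H, ∀ n ∈ H, m < n → θ m < θ n) ∨
         (∀ m ∈ H, ∀ n ∈ H, m < n → θ n < θ m)) →
        ∃ k : Fin l, ∀ m ∈ H, ∀ n ∈ H, m < n → c {m, n} = k := by
  let E := Equiv.ofBijective θ hθ
  have hE : ∀ n, E.symm (θ n) = n := E.symm_apply_apply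
  have hE' : ∀ q, θ (E.symm q) = q := E.apply_symm_apply
  obtain ⟨k₀, k₁, h, hh⟩ :=
    exists_canonical_sequence (fun x y => c {E.symm x, E.symm y}) E.symm.injective θ
  have hmono : StrictMono (h ∘ E.symm) := by
    intro p q hpq
    rcases lt_trichotomy (E.symm p) (E.symm q) with hlt | heq | hlt
    · exact ((hh _ _ hlt).2 (by rwa [hE', hE'])).1
    · exact absurd (E.symm.injective heq) hpq.ne
    · exact ((hh _ _ hlt).1 (by rwa [hE', hE'])).1
  have hlt : ∀ i j, E.symm (h i) < E.symm (h j) →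
      (h i < h j → c {E.symm (h i), E.symm (h j)} = k₁) ∧
      (h j < h i → c {E.symm (h i), E.symm (h j)} = k₀) := by
    intro i j hij
    rcases lt_trichotomy i j with hlt | rfl | hlt
    · rcases lt_or_gt_of_ne (hθ.injective.ne hlt.ne) with ht | ht
      · have := (hh _ _ hlt).2 ht
        exact ⟨fun _ => this.2.2, fun h' => absurd h' this.1.not_gt⟩
      · have := (hh _ _ hlt).1 ht
        exact ⟨fun h' => absurd h' this.1.not_gt, fun _ => this.2.2⟩
    · exact absurd hij (lt_irrefl _)
    · rcases lt_or_gt_of_ne (hθ.injective.ne hlt.ne) with ht | ht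
      · exact absurd hij ((hh _ _ hlt).2 ht).2.1.not_gt
      · exact absurd hij ((hh _ _ hlt).1 ht).2.1.not_gt
  refine ⟨θ ⁻¹' Set.range (h ∘ E.symm), ?_, ?_⟩
  · rw [Set.image_preimage_eq _ hθ.surjective]
    exact ⟨(hmono.orderIso _).symm⟩
  · have hM : ∀ m ∈ θ ⁻¹' Set.range (h ∘ E.symm), ∃ i, h i = θ m := by
      rintro m ⟨q, hq⟩
      exact ⟨_, hq⟩
    rintro H hH (hinc | hdec)
    · refine ⟨k₁, fun m hm n hn hmn => ?_⟩
      obtain ⟨i, hi⟩ := hM m (hH hm)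
      obtain ⟨j, hj⟩ := hM n (hH hn)
      have := hlt i j
      rw [hi, hj, hE, hE] at this
      exact (this hmn).1 (hinc m hm n hn hmn)
    · refine ⟨k₀, fun m hm n hn hmn => ?_⟩
      obtain ⟨i, hi⟩ := hM m (hH hm)
      obtain ⟨j, hj⟩ := hM n (hH hn)
      have := hlt i j
      rw [hi, hj, hE, hE] at this
      exact (this hmn).2 (hdec m hm n hn hmn)
end

section
/- Let θ : ℕ → ℚ ∩ (0,1) be a bijection and define a coloring conv of the 3-element subsets of ℕ with colors {0,1} by: for k < l < m, conv({k,l,m}) = 1 if and only if |θ(l) − θ(m)| < 1/(k+1). Call H ⊆ ℕ i-homogeneous if every 3-element subset of H has color i. Let I be the family of all M ⊆ ℕ such that there exists L ∈ ℕ with the property that every finite 0-homogeneous subset of M has cardinality at most L. Then: (1) I is tall; and (2) for every 2-coloring c of the 2-element subsets of ℕ there exists an infinite set H ⊆ ℕ which is c-homogeneous (all 2-element subsets of H have the same c-color) but H ∉ I, i.e. H contains finite 0-homogeneous subsets (for conv) of arbitrarily large cardinality. -/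
/-- `H` is 0-homogeneous for the coloring `conv` of 3-element subsets of `ℕ`
determined by `θ`: for all `k < l < m` in `H`, `¬(|θ l - θ m| < 1/(k+1))`. -/
def ConvHom0 (θ : ℕ → ℚ) (H : Set ℕ) : Prop :=
  ∀ k ∈ H, ∀ l ∈ H, ∀ m ∈ H, k < l → l < m → ¬(|θ l - θ m| < 1 / ((k : ℚ) + 1))

/-- The ideal of sets all whose finite `conv`-0-homogeneous subsets have
uniformly bounded cardinality. -/
def ConvIdeal (θ : ℕ → ℚ) : Set (Set ℕ) :=
  {M | ∃ L : ℕ, ∀ H : Finset ℕ, (↑H : Set ℕ) ⊆ M → ConvHom0 θ ↑H → H.card ≤ L}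

open Filter Topology

theorem abs_sub_lt_one_div_iff_cast {p q : ℚ} {k : ℕ} :
    |p - q| < 1 / ((k : ℚ) + 1) ↔ |(p : ℝ) - q| < 1 / ((k : ℝ) + 1) := by
  rw [← Rat.cast_lt (K := ℝ)]
  push_cast
  rfl

theorem tall_convIdeal (θ : ℕ → ℚ) (hθ : ∀ n, 0 < θ n ∧ θ n < 1) : Tall (ConvIdeal θ) := by
  intro A hA
  have : (cofinite ⊓ 𝓟 A).NeBot := cofinite_inf_principal_neBot_iff.2 hA
  obtain ⟨W, hW⟩ := Ultrafilter.exists_le (cofinite ⊓ 𝓟 A)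
  have hWA : ∀ᶠ m in (W : Filter ℕ), m ∈ A := le_principal_iff.1 (hW.trans inf_le_right)
  have hWc : (W : Filter ℕ) ≤ atTop := Nat.cofinite_eq_atTop ▸ hW.trans inf_le_left
  obtain ⟨x, -, hx⟩ := (isCompact_Icc (a := (0 : ℝ)) (b := 1)).ultrafilter_le_nhds
    (W.map fun n => (θ n : ℝ)) (by
      refine le_principal_iff.2 (Ultrafilter.mem_map.2 (Eventually.of_forall fun n => ?_))
      exact ⟨Rat.cast_nonneg.2 (hθ n).1.le, show (θ n : ℝ) ≤ 1 from mod_cast (hθ n).2.le⟩)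
  have hx' : Tendsto (fun n => (θ n : ℝ)) W (𝓝 x) := hx
  obtain ⟨b, hbA, hb⟩ := exists_seq_of_forall_finset_exists (fun m => m ∈ A)
    (fun k m => k < m ∧ |(θ m : ℝ) - x| < 1 / (2 * ((k : ℝ) + 1))) (by
      intro s _
      refine (hWA.and ((Finset.eventually_all s).2 fun k _ => ?_)).exists
      refine ((eventually_gt_atTop k).filter_mono hWc).and ?_
      have := Metric.tendsto_nhds.1 hx' (1 / (2 * ((k : ℝ) + 1))) (by positivity)
      simpa [Real.dist_eq] using this)
  have hmono : StrictMono b := fun m n h => (hb m n h).1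
  refine ⟨Set.range b, by rintro _ ⟨n, rfl⟩; exact hbA n,
    Set.infinite_range_of_injective hmono.injective, 2, fun H hH hom => ?_⟩
  by_contra! hcard
  let e := H.orderEmbOfFin rfl
  have he : ∀ j, e j ∈ H := H.orderEmbOfFin_mem rfl
  have h01 : e ⟨0, by lia⟩ < e ⟨1, by lia⟩ := e.strictMono (by simp)
  have h12 : e ⟨1, by lia⟩ < e ⟨2, by lia⟩ := e.strictMono (by simp)
  have hlt := hom _ (he _) _ (he _) _ (he _) h01 h12
  obtain ⟨p, hp⟩ := hH (he ⟨0, by lia⟩)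
  obtain ⟨q, hq⟩ := hH (he ⟨1, by lia⟩)
  obtain ⟨r, hr⟩ := hH (he ⟨2, by lia⟩)
  rw [← hp, ← hq] at h01
  rw [← hq, ← hr] at h12
  rw [← hp, ← hq, ← hr] at hlt
  have hpq := (hb p q (hmono.lt_iff_lt.1 h01)).2
  have hpr := (hb p r (hmono.lt_iff_lt.1 (h01.trans h12))).2
  have h2 : 1 / ((b p : ℝ) + 1) = 1 / (2 * ((b p : ℝ) + 1)) + 1 / (2 * ((b p : ℝ) + 1)) := by
    field_simp
    norm_num
  refine hlt (abs_sub_lt_one_div_iff_cast.2 ?_)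
  rw [h2]
  rw [abs_lt] at hpq hpr ⊢
  constructor <;> linarith [hpq.1, hpq.2, hpr.1, hpr.2]

/-- Infinite Ramsey theorem for pairs, for a possibly asymmetric relation on an infinite set. -/
theorem exists_injective_seq_homogeneous {Y : Type*} (f : Y → Y → Bool → Prop)
    (hf : ∀ x y, f x y true ∨ f x y false) {A : Set Y} (hA : A.Infinite) :
    ∃ b, ∃ y : ℕ → Y, Function.Injective y ∧ (∀ n, y n ∈ A) ∧ ∀ m n, m < n → f (y m) (y n) b := by
  have : (cofinite ⊓ 𝓟 A).NeBot := cofinite_inf_principal_neBot_iff.2 hA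
  obtain ⟨W, hW⟩ := Ultrafilter.exists_le (cofinite ⊓ 𝓟 A)
  have hWA : ∀ᶠ y in (W : Filter Y), y ∈ A := le_principal_iff.1 (hW.trans inf_le_right)
  have hWc : (W : Filter Y) ≤ cofinite := hW.trans inf_le_left
  have key : ∀ x, (∀ᶠ y in (W : Filter Y), f x y true) ∨ ∀ᶠ y in (W : Filter Y), f x y false :=
    fun x => Ultrafilter.eventually_or.1 (Eventually.of_forall (hf x))
  have key' : ∃ b, ∀ᶠ x in (W : Filter Y), ∀ᶠ y in (W : Filter Y), f x y b :=
    (Ultrafilter.eventually_or.1 (Eventually.of_forall key)).elim (⟨_, ·⟩) (⟨_, ·⟩)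
  obtain ⟨b, hb⟩ := key'
  obtain ⟨y, hy, hr⟩ := exists_seq_of_forall_finset_exists
    (fun x => x ∈ A ∧ ∀ᶠ y in (W : Filter Y), f x y b) (fun x y => x ≠ y ∧ f x y b) (by
      intro s hs
      refine ((hWA.and hb).and ((Finset.eventually_all s).2 fun x hx => ?_)).exists
      refine Eventually.and (hWc ?_) (hs x hx).2
      exact (Set.finite_singleton x).subset fun z hz => (not_not.1 hz).symm)
  refine ⟨b, y, fun m n hmn => ?_, fun n => (hy n).1, fun m n h => (hr m n h).2⟩
  by_contra hne
  rcases lt_or_gt_of_ne hne with h | h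
  · exact (hr m n h).1 hmn
  · exact (hr n m h).1 hmn.symm

theorem exists_finite_seq_of_eventually {α : Type*} [Nonempty α] (U : ℕ → Filter α)
    [∀ a, (U a).NeBot] (P : ℕ → α → Prop) (R : α → α → Prop) (K : ℕ)
    (hP : ∀ a < K, ∀ᶠ m in U a, P a m)
    (hR : ∀ a b, a < b → b < K → ∀ m, P a m → ∀ᶠ m' in U b, R m m') :
    ∃ n : ℕ → α, (∀ a < K, P a (n a)) ∧ ∀ a b, a < b → b < K → R (n a) (n b) := by
  induction K with
  | zero => exact ⟨fun _ => Classical.arbitrary α, by simp, by simp⟩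
  | succ K ih =>
    obtain ⟨n, hn, hnR⟩ := ih (fun a ha => hP a (by lia)) (fun a b h hb => hR a b h (by lia))
    obtain ⟨m, hm, hmR⟩ := ((hP K (by lia)).and ((Finset.eventually_all (Finset.range K)).2
      fun a ha => hR a K (Finset.mem_range.1 ha) (by lia) (n a)
        (hn a (Finset.mem_range.1 ha)))).exists
    refine ⟨Function.update n K m, fun a ha => ?_, fun a b hab hb => ?_⟩
    · rcases eq_or_ne a K with rfl | h
      · simpa
      · simpa [h] using hn a (by lia)
    · have haK : a ≠ K := by lia
      rcases eq_or_ne b K with rfl | h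
      · simpa [haK] using hmR a (by simpa)
      · simpa [haK, h] using hnR a b hab (by lia)

section

variable {Y : Type*}

/-- The points `y` such that, for each `(n, b) ∈ G`, the pair `{n, m}` has color `b` for
`U y`-almost all `m`. -/
def colorCell (c : Finset ℕ → Bool) (U : Y → Ultrafilter ℕ) (G : Set (ℕ × Bool)) : Set Y :=
  {y | ∀ p ∈ G, ∀ᶠ m in (U y : Filter ℕ), c {p.1, m} = p.2}

theorem colorCell_anti (c : Finset ℕ → Bool) (U : Y → Ultrafilter ℕ) {G G' : Set (ℕ × Bool)}
    (h : G ⊆ G') : colorCell c U G' ⊆ colorCell c U G :=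
  fun _ hy p hp => hy p (h hp)

/-- `A` contains an infinite sequence which is homogeneous of color `b` for the iterated
ultrafilter limit of the coloring `c`. -/
def HasLimitHomogeneousSeq (c : Finset ℕ → Bool) (U : Y → Ultrafilter ℕ) (b : Bool)
    (A : Set Y) : Prop :=
  ∃ y : ℕ → Y, Function.Injective y ∧ (∀ n, y n ∈ A) ∧ ∀ k l, k < l →
    ∀ᶠ m in (U (y k) : Filter ℕ), ∀ᶠ m' in (U (y l) : Filter ℕ), c {m, m'} = b

theorem HasLimitHomogeneousSeq.mono {c : Finset ℕ → Bool} {U : Y → Ultrafilter ℕ} {b : Bool}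
    {A B : Set Y} (h : HasLimitHomogeneousSeq c U b A) (hAB : A ⊆ B) :
    HasLimitHomogeneousSeq c U b B :=
  let ⟨y, hy, hyA, hyc⟩ := h
  ⟨y, hy, fun n => hAB (hyA n), hyc⟩

theorem exists_hasLimitHomogeneousSeq (c : Finset ℕ → Bool) (U : Y → Ultrafilter ℕ)
    {A : Set Y} (hA : A.Infinite) :
    HasLimitHomogeneousSeq c U true A ∨ HasLimitHomogeneousSeq c U false A := by
  have dich : ∀ (V : Ultrafilter ℕ) (P : ℕ → Bool → Prop), (∀ m, P m true ∨ P m false) →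
      (∀ᶠ m in (V : Filter ℕ), P m true) ∨ ∀ᶠ m in (V : Filter ℕ), P m false :=
    fun V P h => Ultrafilter.eventually_or.1 (Eventually.of_forall h)
  obtain ⟨b, y, h⟩ := exists_injective_seq_homogeneous
    (fun x y b => ∀ᶠ m in (U x : Filter ℕ), ∀ᶠ m' in (U y : Filter ℕ), c {m, m'} = b)
    (fun x y => dich _ (fun m b => ∀ᶠ m' in (U y : Filter ℕ), c {m, m'} = b) fun m =>
      dich _ (fun m' b => c {m, m'} = b) fun m' => by cases c {m, m'} <;> simp) hA
  cases b
  · exact Or.inr ⟨y, h⟩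
  · exact Or.inl ⟨y, h⟩

/-- Discarding countably many points, every nonempty cell is infinite. -/
theorem exists_infinite_colorCell_inter [Uncountable Y] (c : Finset ℕ → Bool)
    (U : Y → Ultrafilter ℕ) :
    ∃ Z : Set Y, Z.Nonempty ∧ ∀ G : Finset (ℕ × Bool),
      (colorCell c U G ∩ Z).Nonempty → (colorCell c U G ∩ Z).Infinite := by
  let B : Set Y := ⋃ G ∈ {G : Finset (ℕ × Bool) | (colorCell c U G).Countable}, colorCell c U G
  have hB : B.Countable := (Set.to_countable _).biUnion fun G hG => hG
  have hinf : ∀ S : Set Y, ¬ S.Countable → (S ∩ Bᶜ).Infinite := by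
    intro S hS hfin
    refine hS ((hfin.countable.union hB).mono fun y hy => ?_)
    by_cases hyB : y ∈ B
    · exact Or.inr hyB
    · exact Or.inl ⟨hy, hyB⟩
  refine ⟨Bᶜ, ?_, fun G ⟨y, hyG, hyB⟩ => hinf _ fun hG => hyB (Set.mem_biUnion hG hyG)⟩
  exact (hinf Set.univ Set.not_countable_univ).nonempty.mono Set.inter_subset_right

theorem exists_hereditarily_hasLimitHomogeneousSeq [Uncountable Y] (c : Finset ℕ → Bool)
    (U : Y → Ultrafilter ℕ) :
    ∃ (b : Bool) (Z : Set Y) (G₀ : Finset (ℕ × Bool)), (colorCell c U G₀ ∩ Z).Nonempty ∧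
      ∀ G : Finset (ℕ × Bool), G₀ ⊆ G → (colorCell c U G ∩ Z).Nonempty →
        HasLimitHomogeneousSeq c U b (colorCell c U G ∩ Z) := by
  obtain ⟨Z, hZ, hZinf⟩ := exists_infinite_colorCell_inter c U
  by_contra! hcon
  obtain ⟨G, -, hG, hGt⟩ := hcon true Z ∅ (by simpa [colorCell] using hZ)
  obtain ⟨G', hGG', hG', hGf⟩ := hcon false Z G hG
  rcases exists_hasLimitHomogeneousSeq c U (hZinf G' hG') with h | h
  · exact hGt (h.mono (Set.inter_subset_inter_left _ (colorCell_anti c U (by simpa using hGG'))))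
  · exact hGf h

theorem exists_pos_le_dist {X : Type*} [MetricSpace X] {y : ℕ → X} (hy : Function.Injective y)
    (K : ℕ) : ∃ δ > 0, ∀ a < K, ∀ b < K, a ≠ b → δ ≤ dist (y a) (y b) := by
  have hev : ∀ᶠ δ in 𝓝[>] (0 : ℝ), ∀ a ∈ Finset.range K, ∀ b ∈ Finset.range K,
      a ≠ b → δ ≤ dist (y a) (y b) := by
    refine (Finset.eventually_all _).2 fun a _ => (Finset.eventually_all _).2 fun b _ => ?_
    by_cases hab : a = b
    · simp [hab]
    · filter_upwards [nhdsWithin_le_nhds (eventually_le_nhds (dist_pos.2 (hy.ne hab)))]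
        with δ h _ using h
  obtain ⟨δ, hδ, hpos⟩ := (hev.and self_mem_nhdsWithin).exists
  exact ⟨δ, hpos, fun a ha b hb => hδ a (by simpa) b (by simpa)⟩

end

theorem convHom0_image_of_near {θ : ℕ → ℚ} {y : ℕ → ℝ} {δ : ℝ} {K : ℕ} {n : ℕ → ℕ}
    (hδ : ∀ a < K, ∀ b < K, a ≠ b → δ ≤ dist (y a) (y b))
    (hnear : ∀ a < K, dist (θ (n a) : ℝ) (y a) < δ / 4)
    (hlarge : ∀ a < K, 1 / ((n a : ℝ) + 1) < δ / 2) :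
    ConvHom0 θ ↑((Finset.range K).image n) := by
  intro k hk l hl m hm _ hlm
  simp only [Finset.coe_image, Set.mem_image, Finset.mem_coe, Finset.mem_range] at hk hl hm
  obtain ⟨a, ha, rfl⟩ := hk
  obtain ⟨b, hb, rfl⟩ := hl
  obtain ⟨d, hd, rfl⟩ := hm
  intro hlt
  rw [abs_sub_lt_one_div_iff_cast, ← Real.dist_eq] at hlt
  have h1 := hδ b hb d hd (by rintro rfl; exact hlm.false)
  have h2 := dist_triangle4 (y b) (θ (n b) : ℝ) (θ (n d)) (y d)
  rw [dist_comm (y b) (θ (n b) : ℝ)] at h2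
  linarith [hnear b hb, hnear d hd, hlarge a ha]

/-- Adjoining a large `conv`-0-homogeneous block to a finite homogeneous set. -/
theorem exists_homogeneous_extension {Y : Set ℝ} {θ : ℕ → ℚ} {c : Finset ℕ → Bool}
    {U : Y → Ultrafilter ℕ} (hU : ∀ y, (U y : Filter ℕ) ≤ atTop)
    (hUθ : ∀ y : Y, Tendsto (fun n => (θ n : ℝ)) (U y) (𝓝 y)) {b : Bool} {A : Set Y}
    (hA : HasLimitHomogeneousSeq c U b A) {E : Finset ℕ}
    (hAE : ∀ y ∈ A, ∀ e ∈ E, ∀ᶠ m in (U y : Filter ℕ), c {e, m} = b)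
    (hE : ∀ m ∈ E, ∀ n ∈ E, m < n → c {m, n} = b) (K : ℕ) :
    ∃ F : Finset ℕ, F.card = K ∧ ConvHom0 θ F ∧
      (∀ m ∈ E ∪ F, ∀ n ∈ E ∪ F, m < n → c {m, n} = b) ∧
      ∃ y ∈ A, ∀ e ∈ E ∪ F, ∀ᶠ m in (U y : Filter ℕ), c {e, m} = b := by
  obtain ⟨y, hy, hyA, hyc⟩ := hA
  obtain ⟨δ, hδ0, hδ⟩ := exists_pos_le_dist hy K
  obtain ⟨n, hP, hR⟩ := exists_finite_seq_of_eventually (fun a => (U (y a) : Filter ℕ))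
    (fun a m => (dist (θ m : ℝ) (y a) < δ / 4 ∧ 1 / ((m : ℝ) + 1) < δ / 2) ∧
      (∀ d ∈ Finset.Ioc a K, ∀ᶠ m' in (U (y d) : Filter ℕ), c {m, m'} = b) ∧
      ∀ e ∈ E, c {e, m} = b)
    (fun m m' => m < m' ∧ c {m, m'} = b) K
    (fun a ha => by
      refine ((Metric.tendsto_nhds.1 (hUθ (y a)) (δ / 4) (by positivity)).and ?_).and
        (((Finset.eventually_all _).2 fun d hd => hyc a d (Finset.mem_Ioc.1 hd).1).and
        ((Finset.eventually_all _).2 fun e he => hAE _ (hyA a) e he))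
      exact hU (y a) (tendsto_one_div_add_atTop_nhds_zero_nat.eventually_lt_const (half_pos hδ0)))
    (fun a d had hd m hm => ((eventually_gt_atTop m).filter_mono (hU (y d))).and
      (hm.2.1 d (Finset.mem_Ioc.2 ⟨had, hd.le⟩)))
  refine ⟨(Finset.range K).image n, ?_, convHom0_image_of_near (y := fun a => (y a : ℝ)) hδ
    (fun a ha => (hP a ha).1.1) (fun a ha => (hP a ha).1.2), ?_, y K, hyA K, ?_⟩
  · rw [Finset.card_image_of_injOn, Finset.card_range]
    intro a ha d hd had
    by_contra hne
    simp only [Finset.coe_range, Set.mem_Iio] at ha hd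
    rcases lt_or_gt_of_ne hne with h | h
    · exact (hR a d h hd).1.ne had
    · exact (hR d a h ha).1.ne' had
  · intro m hm m' hm' hlt
    simp only [Finset.mem_union, Finset.mem_image, Finset.mem_range] at hm hm'
    rcases hm with hm | ⟨a, ha, rfl⟩ <;> rcases hm' with hm' | ⟨d, hd, rfl⟩
    · exact hE m hm m' hm' hlt
    · exact (hP d hd).2.2 m hm
    · rw [Finset.pair_comm]
      exact (hP a ha).2.2 m' hm'
    · rcases lt_trichotomy a d with h | rfl | h
      · exact (hR a d h hd).2
      · exact (hlt.false).elim
      · exact absurd hlt (hR d a h ha).1.not_gt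
  · intro e he
    simp only [Finset.mem_union, Finset.mem_image, Finset.mem_range] at he
    rcases he with he | ⟨a, ha, rfl⟩
    · exact hAE _ (hyA K) e he
    · exact (hP a ha).2.1 K (Finset.mem_Ioc.2 ⟨ha, le_rfl⟩)

theorem exists_ultrafilter_tendsto {θ : ℕ → ℚ} (hinj : Function.Injective θ)
    (hrange : Set.range θ = {q : ℚ | 0 < q ∧ q < 1}) {y : ℝ} (hy : y ∈ Set.Ioo (0 : ℝ) 1) :
    ∃ U : Ultrafilter ℕ, (U : Filter ℕ) ≤ atTop ∧ Tendsto (fun n => (θ n : ℝ)) U (𝓝 y) := by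
  have hinj' : Function.Injective fun n => (θ n : ℝ) := Rat.cast_injective.comp hinj
  have hne : (comap (fun n => (θ n : ℝ)) (𝓝[>] y)).NeBot := by
    refine comap_neBot fun s hs => ?_
    obtain ⟨u, hu, hus⟩ := (mem_nhdsGT_iff_exists_Ioo_subset' hy.2).1 hs
    obtain ⟨q, hq1, hq2⟩ := exists_rat_btwn (lt_min (Set.mem_Ioi.1 hu) hy.2)
    rw [lt_min_iff] at hq2
    have hq : q ∈ Set.range θ := by
      rw [hrange]
      exact ⟨mod_cast hy.1.trans hq1, mod_cast hq2.2⟩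
    obtain ⟨n, rfl⟩ := hq
    exact ⟨n, hus ⟨hq1, hq2.1⟩⟩
  obtain ⟨U, hU⟩ := Ultrafilter.exists_le (comap (fun n => (θ n : ℝ)) (𝓝[>] y))
  have hUt : Tendsto (fun n => (θ n : ℝ)) U (𝓝[>] y) := tendsto_iff_comap.2 hU
  refine ⟨U, ?_, hUt.mono_right nhdsWithin_le_nhds⟩
  rw [← Nat.cofinite_eq_atTop, le_cofinite_iff_eventually_ne]
  intro n
  have hlt : ∀ᶠ x in 𝓝[>] y, x ≠ (θ n : ℝ) := by
    rcases eq_or_ne (θ n : ℝ) y with h | h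
    · filter_upwards [self_mem_nhdsWithin] with x hx
      rw [h]
      exact ne_of_gt hx
    · exact nhdsWithin_le_nhds (eventually_ne_nhds h.symm)
  filter_upwards [hUt.eventually hlt] with m hm hmn
  exact hm (by rw [hmn])

theorem exists_homogeneous_notMem_convIdeal {θ : ℕ → ℚ} (hinj : Function.Injective θ)
    (hrange : Set.range θ = {q : ℚ | 0 < q ∧ q < 1}) (c : Finset ℕ → Bool) :
    ∃ H : Set ℕ, H.Infinite ∧ (∃ b : Bool, ∀ m ∈ H, ∀ n ∈ H, m < n → c {m, n} = b) ∧
      H ∉ ConvIdeal θ := by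
  choose U hU hUθ using fun y : Set.Ioo (0 : ℝ) 1 => exists_ultrafilter_tendsto hinj hrange y.2
  have : Uncountable (Set.Ioo (0 : ℝ) 1) :=
    not_countable_iff.1 fun h => (Cardinal.Real.Ioo_countable_iff.1 h).not_gt one_pos
  obtain ⟨b, Z, G₀, hG₀, hG⟩ := exists_hereditarily_hasLimitHomogeneousSeq c U
  let Q : Finset ℕ → Prop := fun E => (∀ m ∈ E, ∀ n ∈ E, m < n → c {m, n} = b) ∧
    (colorCell c U ↑(G₀ ∪ E.image fun e => (e, b)) ∩ Z).Nonempty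
  have step : ∀ (E : {E // Q E}) (K : ℕ), ∃ E' : {E // Q E}, E.1 ⊆ E'.1 ∧
      ∃ F ⊆ E'.1, F.card = K ∧ ConvHom0 θ F := by
    rintro ⟨E, hE, hEne⟩ K
    obtain ⟨F, hFK, hF, hEF, y, ⟨hy, hyZ⟩, hyEF⟩ := exists_homogeneous_extension hU hUθ
      (hG _ Finset.subset_union_left hEne)
      (fun y hy e he => hy.1 (e, b) (by simp [he])) hE K
    refine ⟨⟨E ∪ F, hEF, y, fun p hp => ?_, hyZ⟩, Finset.subset_union_left, F,
      Finset.subset_union_right, hFK, hF⟩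
    rcases Finset.mem_union.1 (Finset.mem_coe.1 hp) with hp | hp
    · exact hy p (Finset.mem_coe.2 (Finset.mem_union_left _ hp))
    · obtain ⟨e, he, rfl⟩ := Finset.mem_image.1 hp
      exact hyEF e he
  choose S hS F hFS hFcard hF using step
  let E : ℕ → {E // Q E} := fun k => Nat.rec ⟨∅, by simp, by simpa using hG₀⟩ (fun k E => S E k) k
  have hmono : Monotone fun k => (E k).1 := monotone_nat_of_le_succ fun k => hS (E k) k
  have hsub : ∀ k, (F (E k) k : Set ℕ) ⊆ ⋃ k, ((E k).1 : Set ℕ) := fun k =>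
    (Finset.coe_subset.2 (hFS (E k) k)).trans
      (Set.subset_iUnion (fun k => ((E k).1 : Set ℕ)) (k + 1))
  refine ⟨⋃ k, ((E k).1 : Set ℕ), fun hfin => ?_, ⟨b, fun m hm n hn hlt => ?_⟩, ?_⟩
  · have := Finset.card_le_card (t := hfin.toFinset) (s := F (E (hfin.toFinset.card + 1)) _)
      fun x hx => hfin.mem_toFinset.2 (hsub (hfin.toFinset.card + 1) hx)
    rw [hFcard] at this
    lia
  · obtain ⟨k, hk⟩ := Set.mem_iUnion.1 hm
    obtain ⟨l, hl⟩ := Set.mem_iUnion.1 hn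
    exact (E (max k l)).2.1 m (hmono (le_max_left k l) hk) n (hmono (le_max_right k l) hl) hlt
  · rintro ⟨L, hL⟩
    have := hL _ (hsub (L + 1)) (hF _ _)
    rw [hFcard] at this
    lia

theorem stmt18 (θ : ℕ → ℚ) (hinj : Function.Injective θ)
    (hrange : Set.range θ = {q : ℚ | 0 < q ∧ q < 1}) :
    Tall (ConvIdeal θ) ∧
    ∀ c : Finset ℕ → Bool,
      ∃ H : Set ℕ, H.Infinite ∧
        (∃ b : Bool, ∀ m ∈ H, ∀ n ∈ H, m < n → c {m, n} = b) ∧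
        H ∉ ConvIdeal θ :=
  ⟨tall_convIdeal θ fun n => hrange.subset (Set.mem_range_self n),
    exists_homogeneous_notMem_convIdeal hinj hrange⟩
end
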